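/- Let G be a multigraph with a distinguished vertex z, and let k be a positive integer. If G is (3k−3)-edge-connected or contains 2k−2 pairwise edge-disjoint spanning trees, then G can be edge-decomposed into k spanning subgraphs G_1, …, G_k with | |E(G_i)| − |E(G)|/k | < 1 such that for each vertex v ≠ z and each i, |d_{G_i}(v) − d_G(v)/k| < 1, and |d_{G_i}(z) − d_G(z)/k| < 2 for each i. -/

import Mathlib

open Finset

variable {V E : Type*}

/-- Degree of `v` in the sub-multigraph given by the edge set `S`,
where `ends e` gives the two endpoints of edge `e` (loops count twice). -/
def mdeg [DecidableEq V] (ends : E → V × V) (S : Finset E) (v : V) : ℕ :=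
  (S.filter fun e => (ends e).1 = v).card + (S.filter fun e => (ends e).2 = v).card

/-- Number of edges with exactly one end in the vertex set `X`. -/
def cutCard [Fintype E] [DecidableEq V] (ends : E → V × V) (X : Finset V) : ℕ :=
  (univ.filter fun e : E =>
    ((ends e).1 ∈ X ∧ (ends e).2 ∉ X) ∨ ((ends e).1 ∉ X ∧ (ends e).2 ∈ X)).card

/-- `lam`-edge-connectedness: every edge cut has at least `lam` edges. -/
def EdgeConn [Fintype V] [Fintype E] [DecidableEq V] (ends : E → V × V) (lam : ℕ) : Prop :=
  ∀ X : Finset V, X.Nonempty → X ≠ univ → lam ≤ cutCard ends X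

/-- The edge set `T` is a spanning tree: it connects all vertices and has `|V| - 1` edges. -/
def IsSpanningTree [Fintype V] [DecidableEq V] (ends : E → V × V) (T : Finset E) : Prop :=
  (∀ a b : V,
    Relation.ReflTransGen (fun u w => ∃ e ∈ T, ends e = (u, w) ∨ ends e = (w, u)) a b) ∧
  T.card + 1 = Fintype.card V

/-- `m`-tree-connectedness: there are `m` pairwise edge-disjoint spanning trees. -/
def TreeConn [Fintype V] [DecidableEq V] (ends : E → V × V) (m : ℕ) : Prop :=
  ∃ Ts : Fin m → Finset E,
    (∀ i j, i ≠ j → Disjoint (Ts i) (Ts j)) ∧ ∀ i, IsSpanningTree ends (Ts i)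


namespace EqF

/-- Distance of `x` to the nearest multiple of `2k`. -/
def nrm (k x : ℤ) : ℤ := min (x % (2 * k)) (2 * k - x % (2 * k))

lemma nrm_rep {k : ℤ} (hk : 0 < k) (x : ℤ) :
    ∃ y n : ℤ, x = y + 2 * k * n ∧ -k < y ∧ y ≤ k ∧ nrm k x = |y| := by
  have h1 := Int.emod_nonneg x (show 2 * k ≠ 0 by omega)
  have h2 := Int.emod_lt_of_pos x (show 0 < 2 * k by omega)
  have h3 := Int.emod_add_mul_ediv x (2 * k)
  by_cases h : x % (2 * k) ≤ k
  · refine ⟨x % (2 * k), x / (2 * k), by omega, by omega, h, ?_⟩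
    unfold nrm
    rw [abs_of_nonneg h1]; omega
  · refine ⟨x % (2 * k) - 2 * k, x / (2 * k) + 1, ?_, by omega, by omega, ?_⟩
    · rw [mul_add]; omega
    · unfold nrm
      rw [abs_of_neg (by omega)]; omega

lemma nrm_congr {k x y : ℤ} (h : 2 * k ∣ x - y) : nrm k x = nrm k y := by
  have : x % (2 * k) = y % (2 * k) := (Int.modEq_iff_dvd.2 h).symm
  unfold nrm
  rw [this]

lemma nrm_le {k : ℤ} (hk : 0 < k) (x : ℤ) : nrm k x ≤ k := by
  obtain ⟨y, n, _, h1, h2, h3⟩ := nrm_rep hk x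
  rw [h3, abs_le]; omega

lemma nrm_nonneg {k : ℤ} (hk : 0 < k) (x : ℤ) : 0 ≤ nrm k x := by
  obtain ⟨y, n, _, h1, h2, h3⟩ := nrm_rep hk x
  rw [h3]; exact abs_nonneg y

lemma nrm_small {k : ℤ} (hk : 0 < k) {x : ℤ} (h1 : -k ≤ x) (h2 : x ≤ k) : nrm k x = |x| := by
  by_cases hx : 0 ≤ x
  · have : x % (2 * k) = x := Int.emod_eq_of_lt hx (by omega)
    unfold nrm; rw [this, abs_of_nonneg hx]; omega
  · have h : nrm k x = nrm k (x + 2 * k) := nrm_congr ⟨-1, by ring⟩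
    have : (x + 2 * k) % (2 * k) = x + 2 * k := Int.emod_eq_of_lt (by omega) (by omega)
    rw [h]; unfold nrm; rw [this, abs_of_neg (by omega)]; omega

lemma nrm_neg {k : ℤ} (hk : 0 < k) (x : ℤ) : nrm k (-x) = nrm k x := by
  obtain ⟨y, n, h, h1, h2, h3⟩ := nrm_rep hk x
  rw [h3, nrm_congr (y := -y) ⟨-n, by rw [h]; ring⟩, nrm_small hk (by omega) (by omega), abs_neg]

lemma nrm_par {k : ℤ} (hk : 0 < k) (x : ℤ) : nrm k x % 2 = x % 2 := by
  obtain ⟨y, n, h, h1, h2, h3⟩ := nrm_rep hk x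
  have : x = y + 2 * (k * n) := by rw [h]; ring
  rw [h3]
  rcases abs_cases y with ⟨h, _⟩ | ⟨h, _⟩ <;> omega

lemma nrm_le_abs {k : ℤ} (hk : 0 < k) (x : ℤ) : nrm k x ≤ |x| := by
  by_cases h : |x| ≤ k
  · rw [nrm_small hk (abs_le.1 h).1 (abs_le.1 h).2]
  · exact (nrm_le hk x).trans (by omega)

lemma nrm_add {k : ℤ} (hk : 0 < k) (x y : ℤ) : nrm k (x + y) ≤ nrm k x + nrm k y := by
  obtain ⟨a, n, h, h1, h2, h3⟩ := nrm_rep hk x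
  obtain ⟨b, m, h', h1', h2', h3'⟩ := nrm_rep hk y
  rw [h3, h3', nrm_congr (y := a + b) ⟨n + m, by rw [h, h']; ring⟩]
  exact (nrm_le_abs hk _).trans (abs_add_le a b)

lemma nrm_add_abs {k : ℤ} (hk : 0 < k) (x y : ℤ) : nrm k (x + y) ≤ nrm k x + |y| :=
  (nrm_add hk x y).trans (by linarith [nrm_le_abs hk y])

lemma nrm_zero_dvd {k : ℤ} (hk : 0 < k) {x : ℤ} (h : nrm k x = 0) : 2 * k ∣ x := by
  obtain ⟨a, n, h0, h1, h2, h3⟩ := nrm_rep hk x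
  rw [h3, abs_eq_zero] at h
  exact ⟨n, by rw [h0, h]; ring⟩

/-- one step formulas -/
lemma nrm_step {k : ℤ} (hk : 2 ≤ k) (x : ℤ) :
    (nrm k x = 0 ∧ nrm k (x + 1) = 1 ∧ nrm k (x - 1) = 1) ∨
    (nrm k x = k ∧ nrm k (x + 1) = k - 1 ∧ nrm k (x - 1) = k - 1) ∨
    (0 < nrm k x ∧ nrm k x < k ∧ nrm k (x + 1) = nrm k x + 1 ∧ nrm k (x - 1) = nrm k x - 1 ∧
      2 * k ∣ x - nrm k x) ∨
    (0 < nrm k x ∧ nrm k x < k ∧ nrm k (x + 1) = nrm k x - 1 ∧ nrm k (x - 1) = nrm k x + 1 ∧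
      2 * k ∣ x + nrm k x) := by
  have hk0 : 0 < k := by omega
  obtain ⟨a, n, h0, h1, h2, h3⟩ := nrm_rep hk0 x
  have hm : nrm k (x - 1) = nrm k (a - 1) := nrm_congr ⟨n, by rw [h0]; ring⟩
  rw [nrm_small hk0 (x := a - 1) (by omega) (by omega)] at hm
  by_cases hak : a = k
  · have hp : nrm k (x + 1) = nrm k (1 - k) := nrm_congr ⟨n + 1, by rw [h0, hak]; ring⟩
    rw [nrm_small hk0 (x := 1 - k) (by omega) (by omega)] at hp
    right; left
    rw [hm, hp, h3, hak]
    refine ⟨abs_of_nonneg (by omega), ?_, abs_of_nonneg (by omega)⟩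
    rw [abs_of_neg (by omega)]; omega
  · have hp : nrm k (x + 1) = nrm k (a + 1) := nrm_congr ⟨n, by rw [h0]; ring⟩
    rw [nrm_small hk0 (x := a + 1) (by omega) (by omega)] at hp
    rcases lt_trichotomy a 0 with ha | ha | ha
    · right; right; right
      rw [hm, hp, h3, abs_of_neg ha, abs_of_neg (by omega : a - 1 < 0),
        abs_of_nonpos (by omega : a + 1 ≤ 0)]
      exact ⟨by omega, by omega, by omega, by omega, ⟨n, by rw [h0]; ring⟩⟩
    · left
      rw [hm, hp, h3, ha]; simp
    · right; right; left
      rw [hm, hp, h3, abs_of_pos ha, abs_of_nonneg (by omega : 0 ≤ a - 1),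
        abs_of_nonneg (by omega : 0 ≤ a + 1)]
      exact ⟨by omega, by omega, by omega, by omega, ⟨n, by rw [h0]; ring⟩⟩

end EqF

set_option linter.unusedSectionVars false

namespace EqF

section Basics0
variable {V : Type*} [DecidableEq V]

/-- indicator -/
def ind (x : V) (A : Finset V) : ℤ := if x ∈ A then 1 else 0

/-- signed incidence of an edge with a vertex set -/
def inc (p : V × V) (A : Finset V) : ℤ := ind p.1 A - ind p.2 A

lemma ind_mem {x : V} {A : Finset V} (h : x ∈ A) : ind x A = 1 := by simp [ind, h]
lemma ind_not {x : V} {A : Finset V} (h : x ∉ A) : ind x A = 0 := by simp [ind, h]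

lemma ind_sum (x : V) (A : Finset V) : ind x A = ∑ v ∈ A, ind x {v} := by
  simp [ind]

lemma inc_sum (p : V × V) (A : Finset V) : inc p A = ∑ v ∈ A, inc p {v} := by
  simp [inc, ind_sum _ A]

lemma inc_loop (x : V) (A : Finset V) : inc (x, x) A = 0 := by simp [inc]

lemma inc_cases (p : V × V) (A : Finset V) : inc p A = 0 ∨ inc p A = 1 ∨ inc p A = -1 := by
  unfold inc ind; split_ifs <;> simp

lemma sum_ite_ind (x : V) (B : Finset V) (i : ℤ) :
    ∑ v ∈ B, (if v = x then i else 0) = i * ind x B := by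
  simp [ind]

lemma inc_compl {p : V × V} {W A : Finset V} (h1 : p.1 ∈ W) (h2 : p.2 ∈ W) :
    inc p (W \ A) = - inc p A := by
  unfold inc ind; simp only [mem_sdiff, h1, h2, true_and]; split_ifs <;> simp_all

/-- edges with not both ends in `A` hit disjointly -/
lemma inc_abs_sum {p : V × V} {A B : Finset V} (hB : B ⊆ A) (h : ¬ (p.1 ∈ A ∧ p.2 ∈ A)) :
    ∑ v ∈ B, |inc p {v}| = |inc p B| := by
  by_cases h1 : p.1 ∈ A
  · have h2 : p.2 ∉ A := fun h2 => h ⟨h1, h2⟩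
    have : ∀ v ∈ B, |inc p {v}| = ind p.1 {v} := by
      intro v hv
      have : p.2 ≠ v := fun hh => h2 (hh ▸ hB hv)
      simp only [inc, ind, mem_singleton]
      split_ifs <;> simp_all
    rw [sum_congr rfl this, ← ind_sum, inc, ind_not (fun hh => h2 (hB hh))]
    unfold ind; split_ifs <;> simp
  · have : ∀ v ∈ B, |inc p {v}| = ind p.2 {v} := by
      intro v hv
      have : p.1 ≠ v := fun hh => h1 (hh ▸ hB hv)
      simp only [inc, ind, mem_singleton]
      split_ifs <;> simp_all
    rw [sum_congr rfl this, ← ind_sum, inc, ind_not (fun hh => h1 (hB hh))]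
    unfold ind; split_ifs <;> simp

end Basics0

section Basics
variable {V E : Type*} [DecidableEq V] [Fintype E]

/-- cut size -/
def dG (ends : E → V × V) (A : Finset V) : ℤ := ∑ e, |inc (ends e) A|

/-- net flow out of `A` -/
def bd (ends : E → V × V) (s : E → ℤ) (A : Finset V) : ℤ := ∑ e, s e * inc (ends e) A

/-- number of edges that are not loops -/
def nl (ends : E → V × V) : ℕ := (univ.filter fun e => (ends e).1 ≠ (ends e).2).card

/-- sign assignment -/
def Sgn (s : E → ℤ) : Prop := ∀ e, s e = 1 ∨ s e = -1

/-- solution -/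
def Sol (k : ℤ) (W : Finset V) (ends : E → V × V) (ρ : V → ℤ) : Prop :=
  ∃ s : E → ℤ, Sgn s ∧ ∀ v ∈ W, 2 * k ∣ bd ends s {v} - ρ v

/-- all edges live on `W` -/
def OnW (W : Finset V) (ends : E → V × V) : Prop := ∀ e, (ends e).1 ∈ W ∧ (ends e).2 ∈ W

lemma bd_sum (ends : E → V × V) (s : E → ℤ) (A : Finset V) :
    bd ends s A = ∑ v ∈ A, bd ends s {v} := by
  unfold bd
  rw [sum_comm]
  refine sum_congr rfl fun e _ => ?_
  rw [inc_sum, mul_sum]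

lemma bd_W {W : Finset V} {ends : E → V × V} (h : OnW W ends) (s : E → ℤ) :
    bd ends s W = 0 := by
  unfold bd
  refine sum_eq_zero fun e _ => ?_
  simp [inc, ind, (h e).1, (h e).2]

lemma dG_nonneg (ends : E → V × V) (A : Finset V) : 0 ≤ dG ends A :=
  sum_nonneg fun _ _ => abs_nonneg _

lemma dG_compl {W : Finset V} {ends : E → V × V} (h : OnW W ends) (A : Finset V) :
    dG ends (W \ A) = dG ends A := by
  unfold dG
  refine sum_congr rfl fun e _ => ?_
  rw [inc_compl (h e).1 (h e).2, abs_neg]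

lemma bd_par {ends : E → V × V} {s t : E → ℤ} (hs : Sgn s) (ht : Sgn t) (A : Finset V) :
    (2 : ℤ) ∣ bd ends s A - bd ends t A := by
  unfold bd
  rw [← sum_sub_distrib]
  refine dvd_sum fun e _ => ?_
  rw [← sub_mul]
  apply Dvd.dvd.mul_right
  rcases hs e with h | h <;> rcases ht e with h' | h' <;> rw [h, h'] <;> norm_num

lemma dG_par {ends : E → V × V} {s : E → ℤ} (hs : Sgn s) (A : Finset V) :
    (2 : ℤ) ∣ dG ends A - bd ends s A := by
  unfold bd dG
  rw [← sum_sub_distrib]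
  refine dvd_sum fun e _ => ?_
  rcases hs e with h | h <;> rcases inc_cases (ends e) A with h' | h' | h' <;>
    rw [h, h'] <;> norm_num

lemma sgn_one : Sgn (fun _ : E => (1 : ℤ)) := fun _ => Or.inl rfl

/-- positive cut gives a crossing edge -/
lemma exists_cross {ends : E → V × V} {A : Finset V} (h : 0 < dG ends A) :
    ∃ e, inc (ends e) A ≠ 0 := by
  by_contra! hh
  have : dG ends A = 0 := sum_eq_zero fun e _ => by rw [hh e, abs_zero]
  omega

/-- orientation of a nonloop edge -/
lemma inc_orient {p : V × V} {x y : V} (h : p = (x, y) ∨ p = (y, x)) :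
    ∃ η : ℤ, (η = 1 ∨ η = -1) ∧ ∀ B, inc p B = η * (ind x B - ind y B) := by
  rcases h with h | h
  · exact ⟨1, Or.inl rfl, fun B => by rw [h]; simp [inc]⟩
  · exact ⟨-1, Or.inr rfl, fun B => by rw [h]; simp [inc]⟩

section upd
variable [DecidableEq E]

lemma sum_upd (ends : E → V × V) (e : E) (p : V × V) (F : E → V × V → ℤ) :
    ∑ f, F f (Function.update ends e p f) = ∑ f, F f (ends f) + (F e p - F e (ends e)) := by
  rw [← add_sum_erase univ _ (mem_univ e), ← add_sum_erase univ (fun f => F f (ends f)) (mem_univ e)]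
  have : ∑ x ∈ univ.erase e, F x (Function.update ends e p x) = ∑ x ∈ univ.erase e, F x (ends x) :=
    sum_congr rfl fun x hx => by rw [Function.update_of_ne (ne_of_mem_erase hx)]
  rw [this, Function.update_self]; ring

lemma dG_upd (ends : E → V × V) (e : E) (p : V × V) (A : Finset V) :
    dG (Function.update ends e p) A = dG ends A + (|inc p A| - |inc (ends e) A|) :=
  sum_upd ends e p fun _ q => |inc q A|

lemma bd_upd (ends : E → V × V) (s : E → ℤ) (e : E) (p : V × V) (A : Finset V) :
    bd (Function.update ends e p) s A = bd ends s A + (s e * inc p A - s e * inc (ends e) A) :=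
  sum_upd ends e p fun f q => s f * inc q A

lemma bd_upds (ends : E → V × V) (s : E → ℤ) (e : E) (t : ℤ) (A : Finset V) :
    bd ends (Function.update s e t) A = bd ends s A + (t - s e) * inc (ends e) A := by
  unfold bd
  rw [← add_sum_erase univ _ (mem_univ e), ← add_sum_erase univ (fun f => s f * inc (ends f) A) (mem_univ e)]
  have : ∑ x ∈ univ.erase e, Function.update s e t x * inc (ends x) A
      = ∑ x ∈ univ.erase e, s x * inc (ends x) A :=
    sum_congr rfl fun x hx => by rw [Function.update_of_ne (ne_of_mem_erase hx)]
  rw [this, Function.update_self]; ring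

lemma sgn_upd {s : E → ℤ} (hs : Sgn s) (e : E) {t : ℤ} (ht : t = 1 ∨ t = -1) :
    Sgn (Function.update s e t) := by
  intro f
  by_cases h : f = e
  · subst h; simpa using ht
  · rw [Function.update_of_ne h]; exact hs f

lemma nl_upd_lt (ends : E → V × V) (e : E) (x : V) (h : (ends e).1 ≠ (ends e).2) :
    nl (Function.update ends e (x, x)) < nl ends := by
  unfold nl
  apply card_lt_card
  refine ⟨fun f hf => ?_, fun hh => ?_⟩
  · simp only [mem_filter, mem_univ, true_and] at hf ⊢
    by_cases hfe : f = e
    · subst hfe; exact h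
    · rwa [Function.update_of_ne hfe] at hf
  · have := hh (show e ∈ _ by simp [h])
    simp at this

lemma onW_upd {W : Finset V} {ends : E → V × V} (h : OnW W ends) (e : E) {p : V × V}
    (h1 : p.1 ∈ W) (h2 : p.2 ∈ W) : OnW W (Function.update ends e p) := by
  intro f
  by_cases hf : f = e
  · subst hf; simpa using ⟨h1, h2⟩
  · rw [Function.update_of_ne hf]; exact h f

end upd

/-- The inductive hypothesis of the core theorem. -/
structure Good (k : ℤ) (W : Finset V) (ends : E → V × V) (ρ σ c : V → ℤ) (ex : Option V) :
    Prop where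
  onW : OnW W ends
  rho : 2 * k ∣ ∑ v ∈ W, ρ v
  par : ∀ v ∈ W, (2 : ℤ) ∣ ρ v - bd ends (fun _ => 1) {v}
  gle : ∀ v ∈ W, |ρ v - σ v| ≤ c v
  gpar : ∀ v ∈ W, (2 : ℤ) ∣ c v - (ρ v - σ v)
  tot : ∑ v ∈ W, c v ≤ 2 * k - 2 + nrm k (∑ v ∈ W, σ v)
  cut : ∀ A ⊆ W, A.Nonempty → A ≠ W → (∀ x ∈ ex, A ≠ {x}) →
    2 * k - 2 + nrm k (∑ v ∈ A, σ v) ≤ dG ends A + ∑ v ∈ A, c v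
  exd : ∀ x ∈ ex, x ∈ W → 2 * k ∣ σ x

/-- parity of sums of `ρ` -/
lemma par_sum {W : Finset V} {ends : E → V × V} {ρ : V → ℤ}
    (h : ∀ v ∈ W, (2 : ℤ) ∣ ρ v - bd ends (fun _ => 1) {v}) {A : Finset V} (hA : A ⊆ W) :
    (2 : ℤ) ∣ ∑ v ∈ A, ρ v - dG ends A := by
  have h1 : (2 : ℤ) ∣ ∑ v ∈ A, ρ v - bd ends (fun _ => 1) A := by
    rw [bd_sum, ← sum_sub_distrib]; exact dvd_sum fun v hv => h v (hA hv)
  have h2 := dG_par (ends := ends) sgn_one A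
  omega

lemma Good.parity {k : ℤ} {W : Finset V} {ends : E → V × V} {ρ σ c : V → ℤ} {ex : Option V}
    (h : Good k W ends ρ σ c ex) {A : Finset V} (hA : A ⊆ W) :
    (2 : ℤ) ∣ dG ends A + ∑ v ∈ A, c v - ∑ v ∈ A, σ v := by
  have h1 := par_sum h.par hA
  have h3 : (2 : ℤ) ∣ ∑ v ∈ A, c v - (∑ v ∈ A, ρ v - ∑ v ∈ A, σ v) := by
    rw [← sum_sub_distrib, ← sum_sub_distrib]; exact dvd_sum fun v hv => h.gpar v (hA hv)
  omega

end Basics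
end EqF

set_option linter.unusedSectionVars false
set_option linter.unusedVariables false

namespace EqF

section Tools
variable {V E : Type*} [DecidableEq V] [Fintype E]

lemma sign_sum [DecidableEq E] (a : E → ℤ) (ha : ∀ e, a e = 0 ∨ a e = 1 ∨ a e = -1) (F : Finset E) :
    ∀ y : ℤ, |y| ≤ ∑ e ∈ F, |a e| → (2 : ℤ) ∣ y - ∑ e ∈ F, |a e| →
      ∃ s : E → ℤ, Sgn s ∧ ∑ e ∈ F, s e * a e = y := by
  induction F using Finset.induction_on with
  | empty =>
    intro y hy _
    refine ⟨fun _ => 1, sgn_one, ?_⟩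
    simp at hy ⊢; exact hy.symm
  | insert e F he ih =>
    intro y hy h2
    rw [sum_insert he] at hy h2
    have key : ∀ y' : ℤ, |y'| ≤ ∑ e ∈ F, |a e| → (2 : ℤ) ∣ y' - ∑ e ∈ F, |a e| →
        (∃ t : ℤ, (t = 1 ∨ t = -1) ∧ t * a e + y' = y) →
        ∃ s : E → ℤ, Sgn s ∧ ∑ e ∈ insert e F, s e * a e = y := by
      rintro y' h1 h2 ⟨t, ht, hh⟩
      obtain ⟨s, hs, hsum⟩ := ih y' h1 h2
      refine ⟨Function.update s e t, sgn_upd hs e ht, ?_⟩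
      rw [sum_insert he, Function.update_self, ← hh, ← hsum]
      congr 1
      refine sum_congr rfl fun f hf => ?_
      rw [Function.update_of_ne (fun hh : f = e => he (hh ▸ hf))]
    have hD : 0 ≤ ∑ e ∈ F, |a e| := sum_nonneg fun _ _ => abs_nonneg _
    generalize ∑ e ∈ F, |a e| = D at *
    rcases ha e with h | h | h
    · rw [h] at hy h2
      simp only [abs_zero, zero_add] at hy h2
      exact key y hy h2 ⟨1, Or.inl rfl, by rw [h]; ring⟩
    · rw [h] at hy h2
      simp only [abs_one] at hy h2
      rw [abs_le] at hy
      by_cases h0 : 0 < y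
      · exact key (y - 1) (by rw [abs_le]; omega) (by omega) ⟨1, Or.inl rfl, by rw [h]; ring⟩
      · exact key (y + 1) (by rw [abs_le]; omega) (by omega) ⟨-1, Or.inr rfl, by rw [h]; ring⟩
    · rw [h] at hy h2
      simp only [abs_neg, abs_one] at hy h2
      rw [abs_le] at hy
      by_cases h0 : 0 < y
      · exact key (y - 1) (by rw [abs_le]; omega) (by omega) ⟨-1, Or.inr rfl, by rw [h]; ring⟩
      · exact key (y + 1) (by rw [abs_le]; omega) (by omega) ⟨1, Or.inl rfl, by rw [h]; ring⟩

lemma star {k : ℤ} (hk : 0 < k) (ends : E → V × V) (x : V) (r : ℤ) (s0 : E → ℤ) (hs0 : Sgn s0)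
    (h1 : (2 : ℤ) ∣ r - dG ends {x}) (h2 : nrm k r ≤ dG ends {x}) :
    ∃ s : E → ℤ, Sgn s ∧ (∀ e, inc (ends e) {x} = 0 → s e = s0 e) ∧
      2 * k ∣ bd ends s {x} - r := by
  classical
  obtain ⟨y, n, hy, _, _, hn⟩ := nrm_rep hk r
  have hyr : y = r - 2 * (k * n) := by rw [hy]; ring
  obtain ⟨s, hs, hsum⟩ := sign_sum (fun e => inc (ends e) {x}) (fun e => inc_cases _ _) univ y
    (by rw [← hn]; exact h2) (by unfold dG at h1; omega)
  refine ⟨fun e => if inc (ends e) {x} = 0 then s0 e else s e, ?_, ?_, ?_⟩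
  · intro e; dsimp only; split_ifs
    · exact hs0 e
    · exact hs e
  · intro e he; simp [he]
  · have : bd ends (fun e => if inc (ends e) {x} = 0 then s0 e else s e) {x} = y := by
      rw [← hsum]; unfold bd
      refine sum_congr rfl fun e _ => ?_
      dsimp only
      split_ifs with h <;> simp [h]
    rw [this, hyr]
    exact ⟨-n, by ring⟩

/-- contraction of `A` to `a` -/
def cE (A : Finset V) (a : V) (ends : E → V × V) (e : E) : V × V :=
  (if (ends e).1 ∈ A then a else (ends e).1, if (ends e).2 ∈ A then a else (ends e).2)

/-- contraction of vertex weights -/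
def cF (A : Finset V) (a : V) (ρ : V → ℤ) (v : V) : ℤ := if v = a then ∑ u ∈ A, ρ u else ρ v

/-- preimage under contraction -/
def pre (A : Finset V) (a : V) (B : Finset V) : Finset V := if a ∈ B then B ∪ A else B

lemma inc_cE {W A : Finset V} {a : V} (ha : a ∈ A) {B : Finset V}
    (hB : B ⊆ insert a (W \ A)) (ends : E → V × V) (e : E) :
    inc (cE A a ends e) B = inc (ends e) (pre A a B) := by
  have key : ∀ x : V, ind (if x ∈ A then a else x) B = ind x (pre A a B) := by
    intro x
    unfold ind pre
    by_cases hx : x ∈ A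
    · by_cases hb : a ∈ B
      · simp [hx, hb]
      · have : x ∉ B := fun h => by
          have := hB h
          simp only [mem_insert, mem_sdiff] at this
          rcases this with h1 | h1
          · exact hb (h1 ▸ h)
          · exact h1.2 hx
        simp [hx, hb, this]
    · by_cases hb : a ∈ B <;> simp [hx, hb]
  unfold inc cE
  simp only [key]

lemma sum_cF {W A : Finset V} {a : V} (ha : a ∈ A) {B : Finset V}
    (hB : B ⊆ insert a (W \ A)) (ρ : V → ℤ) :
    ∑ v ∈ B, cF A a ρ v = ∑ v ∈ pre A a B, ρ v := by
  unfold pre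
  split_ifs with hb
  · rw [← add_sum_erase B _ hb]
    have h1 : ∑ x ∈ B.erase a, cF A a ρ x = ∑ x ∈ B.erase a, ρ x :=
      sum_congr rfl fun x hx => by simp [cF, ne_of_mem_erase hx]
    have h2 : B ∪ A = A ∪ B.erase a := by
      ext x; simp only [mem_union, mem_erase]
      constructor
      · rintro (h | h)
        · by_cases hx : x = a
          · left; rw [hx]; exact ha
          · right; exact ⟨hx, h⟩
        · left; exact h
      · rintro (h | h)
        · right; exact h
        · left; exact h.2
    have h3 : Disjoint A (B.erase a) := by
      rw [disjoint_left]
      intro x hx hx2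
      have := hB (mem_of_mem_erase hx2)
      simp only [mem_insert, mem_sdiff] at this
      rcases this with h | h
      · exact (ne_of_mem_erase hx2) h
      · exact h.2 hx
    rw [h2, sum_union h3, h1]; simp [cF]
  · exact sum_congr rfl fun x hx => by
      have : x ≠ a := fun h => hb (h ▸ hx)
      simp [cF, this]

lemma dG_cE {W A : Finset V} {a : V} (ha : a ∈ A) {B : Finset V}
    (hB : B ⊆ insert a (W \ A)) (ends : E → V × V) :
    dG (cE A a ends) B = dG ends (pre A a B) := by
  unfold dG; exact sum_congr rfl fun e _ => by rw [inc_cE ha hB]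

lemma bd_cE {W A : Finset V} {a : V} (ha : a ∈ A) {B : Finset V}
    (hB : B ⊆ insert a (W \ A)) (ends : E → V × V) (s : E → ℤ) :
    bd (cE A a ends) s B = bd ends s (pre A a B) := by
  unfold bd; exact sum_congr rfl fun e _ => by rw [inc_cE ha hB]

lemma pre_single_a {A : Finset V} {a : V} (ha : a ∈ A) : pre A a {a} = A := by
  simp [pre, ha]

lemma pre_single {A : Finset V} {a v : V} (h : v ≠ a) : pre A a {v} = {v} := by
  simp [pre, h.symm]

lemma pre_W {W A : Finset V} {a : V} (ha : a ∈ A) (hA : A ⊆ W) :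
    pre A a (insert a (W \ A)) = W := by
  ext x
  have := @hA x
  by_cases h : x = a
  · subst h; simp [pre, ha, hA ha]
  · by_cases hx : x ∈ A <;> simp_all [pre]

lemma pre_sub {W A : Finset V} {a : V} (hA : A ⊆ W) (ha : a ∈ A) {B : Finset V}
    (hB : B ⊆ insert a (W \ A)) : pre A a B ⊆ W := by
  have hB' : B ⊆ W := fun x hx => by
    have := hB hx
    simp only [mem_insert, mem_sdiff] at this
    rcases this with h | h
    · rw [h]; exact hA ha
    · exact h.1
  unfold pre; split_ifs
  · exact union_subset hB' hA
  · exact hB'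

lemma pre_ne {W A : Finset V} {a : V} (hA : A ⊆ W) (ha : a ∈ A) {B : Finset V}
    (hB : B ⊆ insert a (W \ A)) (hne : B ≠ insert a (W \ A)) : pre A a B ≠ W := by
  intro h
  apply hne
  refine subset_antisymm hB fun x hx => ?_
  have hab : a ∈ B := by
    by_contra hab
    have : a ∈ pre A a B := by rw [h]; exact hA ha
    simp [pre, hab] at this
  rw [mem_insert] at hx
  rcases hx with hx | hx
  · rw [hx]; exact hab
  · rw [mem_sdiff] at hx
    have : x ∈ pre A a B := by rw [h]; exact hx.1
    simp only [pre, hab, if_true, mem_union] at this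
    exact this.resolve_right hx.2

lemma pre_nonempty {A : Finset V} {a : V} {B : Finset V} (h : B.Nonempty) :
    (pre A a B).Nonempty := by
  unfold pre; split_ifs
  · exact h.mono subset_union_left
  · exact h

lemma onW_cE {W A : Finset V} {a : V} {ends : E → V × V} (h : OnW W ends) :
    OnW (insert a (W \ A)) (cE A a ends) := by
  intro e
  unfold cE
  constructor
  · dsimp only; split_ifs with h1
    · exact mem_insert_self _ _
    · exact mem_insert_of_mem (mem_sdiff.2 ⟨(h e).1, h1⟩)
  · dsimp only; split_ifs with h1
    · exact mem_insert_self _ _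
    · exact mem_insert_of_mem (mem_sdiff.2 ⟨(h e).2, h1⟩)

lemma card_cW {W A : Finset V} {a : V} (ha : a ∈ A) (hA : A ⊆ W) (h2 : 2 ≤ A.card) :
    (insert a (W \ A)).card < W.card := by
  have h1 := card_insert_le a (W \ A)
  have h3 := card_sdiff_add_card_eq_card hA
  omega

lemma single_sub {W A : Finset V} {a v : V} (h : v ∈ insert a (W \ A)) :
    ({v} : Finset V) ⊆ insert a (W \ A) := by simpa using h

/-- basic parts of contraction -/
lemma contr_rho {k : ℤ} {W A : Finset V} {a : V} (ha : a ∈ A) (hA : A ⊆ W) {ρ : V → ℤ}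
    (h : 2 * k ∣ ∑ v ∈ W, ρ v) : 2 * k ∣ ∑ v ∈ insert a (W \ A), cF A a ρ v := by
  rw [sum_cF ha (subset_refl _), pre_W ha hA]; exact h

lemma contr_par {W A : Finset V} {a : V} (ha : a ∈ A) (hA : A ⊆ W) {ρ : V → ℤ}
    {ends : E → V × V} (h : ∀ v ∈ W, (2 : ℤ) ∣ ρ v - bd ends (fun _ => 1) {v}) :
    ∀ v ∈ insert a (W \ A), (2 : ℤ) ∣ cF A a ρ v - bd (cE A a ends) (fun _ => 1) {v} := by
  intro v hv
  rw [bd_cE ha (single_sub hv)]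
  have h1 := sum_cF ha (single_sub hv) ρ
  rw [sum_singleton] at h1
  have h2 := pre_sub hA ha (single_sub hv)
  rw [h1, bd_sum, ← sum_sub_distrib]
  exact dvd_sum fun u hu => h u (h2 hu)

lemma contr_sol {k : ℤ} {W A : Finset V} {a : V} (ha : a ∈ A) {ρ : V → ℤ}
    {ends : E → V × V} (h : Sol k (insert a (W \ A)) (cE A a ends) (cF A a ρ)) :
    ∃ s : E → ℤ, Sgn s ∧ (∀ v ∈ W \ A, 2 * k ∣ bd ends s {v} - ρ v) ∧
      2 * k ∣ bd ends s A - ∑ v ∈ A, ρ v := by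
  obtain ⟨s, hs, h⟩ := h
  refine ⟨s, hs, fun v hv => ?_, ?_⟩
  · have hva : v ≠ a := fun hh => (mem_sdiff.1 hv).2 (hh ▸ ha)
    have hv' : v ∈ insert a (W \ A) := mem_insert_of_mem hv
    have := h v hv'
    rw [bd_cE ha (single_sub hv'), pre_single hva] at this
    simpa [cF, hva] using this
  · have hv' : a ∈ insert a (W \ A) := mem_insert_self _ _
    have := h a hv'
    rw [bd_cE ha (single_sub hv'), pre_single_a ha] at this
    simpa [cF] using this

lemma contr_good {k : ℤ} {W A : Finset V} {a : V} (ha : a ∈ A) (hA : A ⊆ W)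
    {ends : E → V × V} {ρ σ c : V → ℤ} {ex : Option V} (hG : Good k W ends ρ σ c ex)
    (hA2 : 2 ≤ A.card) (hae : ∀ x ∈ ex, x ≠ a) :
    Good k (insert a (W \ A)) (cE A a ends) (cF A a ρ) (cF A a σ) (cF A a c) ex where
  onW := onW_cE hG.onW
  rho := contr_rho ha hA hG.rho
  par := contr_par ha hA hG.par
  gle := by
    intro v hv
    have h2 := pre_sub hA ha (single_sub hv)
    have h1 := fun r => sum_cF ha (single_sub hv) r
    simp only [sum_singleton] at h1
    rw [h1, h1, h1, ← sum_sub_distrib]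
    exact (abs_sum_le_sum_abs _ _).trans (sum_le_sum fun u hu => hG.gle u (h2 hu))
  gpar := by
    intro v hv
    have h2 := pre_sub hA ha (single_sub hv)
    have h1 := fun r => sum_cF ha (single_sub hv) r
    simp only [sum_singleton] at h1
    rw [h1, h1, h1, ← sum_sub_distrib, ← sum_sub_distrib]
    exact dvd_sum fun u hu => hG.gpar u (h2 hu)
  tot := by
    rw [sum_cF ha (subset_refl _), sum_cF ha (subset_refl _), pre_W ha hA]; exact hG.tot
  cut := by
    intro B hB hne hB2 hex
    rw [sum_cF ha hB, sum_cF ha hB, dG_cE ha hB]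
    apply hG.cut _ (pre_sub hA ha hB) (pre_nonempty hne) (pre_ne hA ha hB hB2)
    intro x hx hpx
    have h3 := hex x hx
    unfold pre at hpx
    split_ifs at hpx with hb
    · have : A ⊆ {x} := by rw [← hpx]; exact subset_union_right
      have := card_le_card this
      simp at this; omega
    · exact h3 hpx
  exd := by
    intro x hx hxW
    have : x ≠ a := hae x hx
    simp only [cF, this, if_false]
    apply hG.exd x hx
    rw [mem_insert, mem_sdiff] at hxW
    exact (hxW.resolve_left this).1

/-- inside edges -/
def isIn (A : Finset V) (p : V × V) : Prop := p.1 ∈ A ∧ p.2 ∈ A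

instance (A : Finset V) (p : V × V) : Decidable (isIn A p) := by unfold isIn; infer_instance

/-- edges of the inner graph -/
def iE (A : Finset V) (a : V) (ends : E → V × V) (e : E) : V × V :=
  if isIn A (ends e) then ends e else (a, a)

/-- demand of the inner graph -/
def iR (A : Finset V) (ends : E → V × V) (s : E → ℤ) (ρ : V → ℤ) (v : V) : ℤ :=
  ρ v - ∑ e, if isIn A (ends e) then 0 else s e * inc (ends e) {v}

/-- slack of the inner graph -/
def iC (A : Finset V) (ends : E → V × V) (c : V → ℤ) (v : V) : ℤ :=
  c v + ∑ e, if isIn A (ends e) then 0 else |inc (ends e) {v}|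

lemma bd_iE (A : Finset V) (a : V) (ends : E → V × V) (s : E → ℤ) (B : Finset V) :
    bd (iE A a ends) s B = ∑ e, if isIn A (ends e) then s e * inc (ends e) B else 0 := by
  unfold bd iE
  refine sum_congr rfl fun e _ => ?_
  split_ifs <;> simp [inc_loop]

lemma onW_iE {A : Finset V} {a : V} (ha : a ∈ A) (ends : E → V × V) : OnW A (iE A a ends) := by
  intro e; unfold iE; split_ifs with h
  · exact h
  · exact ⟨ha, ha⟩

lemma iE_rho {k : ℤ} {A : Finset V} {ends : E → V × V} {s : E → ℤ} {ρ : V → ℤ}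
    (h : 2 * k ∣ bd ends s A - ∑ v ∈ A, ρ v) : 2 * k ∣ ∑ v ∈ A, iR A ends s ρ v := by
  have : ∑ v ∈ A, iR A ends s ρ v = ∑ v ∈ A, ρ v - bd ends s A := by
    unfold iR bd
    rw [sum_sub_distrib, sum_comm]
    congr 1
    refine sum_congr rfl fun e _ => ?_
    split_ifs with h
    · simp [inc, ind, h.1, h.2]
    · rw [inc_sum, mul_sum]
  rw [this, ← neg_sub, Int.dvd_neg]; exact h

lemma iE_par {W A : Finset V} {ends : E → V × V} {s : E → ℤ} {ρ : V → ℤ} (hs : Sgn s)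
    (hA : A ⊆ W) (a : V)
    (h : ∀ v ∈ W, (2 : ℤ) ∣ ρ v - bd ends (fun _ => 1) {v}) :
    ∀ v ∈ A, (2 : ℤ) ∣ iR A ends s ρ v - bd (iE A a ends) (fun _ => 1) {v} := by
  intro v hv
  have h1 := h v (hA hv)
  have h2 : (2 : ℤ) ∣ bd ends (fun _ => 1) {v} - (∑ e, (if isIn A (ends e) then 0 else s e * inc (ends e) {v})
      + bd (iE A a ends) (fun _ => 1) {v}) := by
    rw [bd_iE, ← sum_add_distrib]
    unfold bd
    rw [← sum_sub_distrib]
    refine dvd_sum fun e _ => ?_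
    split_ifs
    · simp
    · rcases hs e with h | h <;> rw [h]
      · simp
      · exact ⟨inc (ends e) {v}, by ring⟩
  unfold iR; omega

/-- combining the two solutions -/
lemma split_sol {k : ℤ} {W A : Finset V} {a : V} {ends : E → V × V} {ρ : V → ℤ} {s : E → ℤ}
    (hs : Sgn s) (hA : A ⊆ W) (h : ∀ v ∈ W \ A, 2 * k ∣ bd ends s {v} - ρ v)
    (h2 : Sol k A (iE A a ends) (iR A ends s ρ)) : Sol k W ends ρ := by
  obtain ⟨t, ht, h2⟩ := h2
  refine ⟨fun e => if isIn A (ends e) then t e else s e, ?_, ?_⟩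
  · intro e; dsimp only; split_ifs
    · exact ht e
    · exact hs e
  · intro v hv
    by_cases hvA : v ∈ A
    · have h3 := h2 v hvA
      have : bd ends (fun e => if isIn A (ends e) then t e else s e) {v} - ρ v =
          bd (iE A a ends) t {v} - iR A ends s ρ v := by
        rw [bd_iE]; unfold bd iR
        rw [sub_sub_eq_add_sub, ← sum_add_distrib]
        congr 1
        refine sum_congr rfl fun e _ => ?_
        dsimp only
        split_ifs <;> ring
      rw [this]; exact h3
    · have h3 := h v (mem_sdiff.2 ⟨hv, hvA⟩)
      have : bd ends (fun e => if isIn A (ends e) then t e else s e) {v} = bd ends s {v} := by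
        unfold bd
        refine sum_congr rfl fun e _ => ?_
        dsimp only
        split_ifs with h
        · have h5 : (ends e).1 ≠ v := fun hh => hvA (hh ▸ h.1)
          have h6 : (ends e).2 ≠ v := fun hh => hvA (hh ▸ h.2)
          simp [inc, ind, h5, h6]
        · rfl
      rw [this]; exact h3

lemma dc_iE {A : Finset V} (a : V) (ends : E → V × V) (c : V → ℤ) {B : Finset V} (hB : B ⊆ A) :
    dG (iE A a ends) B + ∑ v ∈ B, iC A ends c v = dG ends B + ∑ v ∈ B, c v := by
  unfold iC
  rw [sum_add_distrib, sum_comm, ← add_assoc, add_right_comm]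
  congr 1
  unfold dG
  rw [← sum_add_distrib]
  refine sum_congr rfl fun e _ => ?_
  unfold iE
  split_ifs with h
  · simp
  · rw [inc_abs_sum hB h, inc_loop]; simp

lemma inner_good {k : ℤ} {W A : Finset V} {a : V} (ha : a ∈ A) (hA : A ⊆ W)
    {ends : E → V × V} {ρ σ c : V → ℤ} {ex : Option V} {s : E → ℤ} (hs : Sgn s)
    (par : ∀ v ∈ W, (2 : ℤ) ∣ ρ v - bd ends (fun _ => 1) {v})
    (gle : ∀ v ∈ W, |ρ v - σ v| ≤ c v)
    (gpar : ∀ v ∈ W, (2 : ℤ) ∣ c v - (ρ v - σ v))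
    (exd : ∀ x ∈ ex, x ∈ A → 2 * k ∣ σ x)
    (cut : ∀ B ⊆ A, B.Nonempty → B ≠ A → (∀ x ∈ ex, B ≠ {x}) →
      2 * k - 2 + nrm k (∑ v ∈ B, σ v) ≤ dG ends B + ∑ v ∈ B, c v)
    (tight : dG ends A + ∑ v ∈ A, c v ≤ 2 * k - 2 + nrm k (∑ v ∈ A, σ v))
    (hsA : 2 * k ∣ bd ends s A - ∑ v ∈ A, ρ v) :
    Good k A (iE A a ends) (iR A ends s ρ) σ (iC A ends c) ex where
  onW := onW_iE ha ends
  rho := iE_rho hsA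
  par := iE_par hs hA a par
  gle := by
    intro v hv
    unfold iR iC
    have h1 := gle v (hA hv)
    have h2 : |∑ e, if isIn A (ends e) then 0 else s e * inc (ends e) {v}| ≤
        ∑ e, if isIn A (ends e) then 0 else |inc (ends e) {v}| := by
      refine (abs_sum_le_sum_abs _ _).trans (sum_le_sum fun e _ => ?_)
      split_ifs
      · simp
      · rcases hs e with h | h <;> rw [h] <;> simp
    rw [abs_le] at *
    omega
  gpar := by
    intro v hv
    unfold iR iC
    have h1 := gpar v (hA hv)
    have h2 : (2 : ℤ) ∣ (∑ e, if isIn A (ends e) then 0 else |inc (ends e) {v}|) -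
        ∑ e, if isIn A (ends e) then 0 else s e * inc (ends e) {v} := by
      rw [← sum_sub_distrib]
      refine dvd_sum fun e _ => ?_
      split_ifs
      · simp
      · rcases hs e with h | h <;> rcases inc_cases (ends e) {v} with h' | h' | h' <;>
          rw [h, h'] <;> norm_num
    omega
  tot := by
    have h1 := dc_iE a ends c (subset_refl A)
    have h2 := dG_nonneg (iE A a ends) A
    omega
  cut := by
    intro B hB hne hB2 hex
    rw [dc_iE a ends c hB]
    exact cut B hB hne hB2 hex
  exd := exd

end Tools
end EqF

set_option linter.unusedSectionVars false
set_option linter.unusedVariables false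

namespace EqF

section Core
variable {V E : Type*} [DecidableEq V] [Fintype E]

/-- induction hypothesis, fewer vertices -/
def IHn (k : ℤ) (W : Finset V) (E : Type*) [Fintype E] : Prop :=
  ∀ (W' : Finset V) (ends : E → V × V) (ρ σ c : V → ℤ) (ex : Option V),
    W'.card < W.card → Good k W' ends ρ σ c ex → Sol k W' ends ρ

/-- induction hypothesis, fewer edges -/
def IHm (k : ℤ) (W : Finset V) (ends : E → V × V) : Prop :=
  ∀ (ends' : E → V × V) (ρ σ c : V → ℤ) (ex : Option V),
    nl ends' < nl ends → Good k W ends' ρ σ c ex → Sol k W ends' ρ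

/-- induction hypothesis, less slack -/
def IHl (k : ℤ) (W : Finset V) (ends : E → V × V) (c : V → ℤ) : Prop :=
  ∀ (ρ σ c' : V → ℤ) (ex : Option V),
    (∑ v ∈ W, c' v).toNat < (∑ v ∈ W, c v).toNat → Good k W ends ρ σ c' ex → Sol k W ends ρ

/-- all larger cuts are not tight -/
def Slack (k : ℤ) (W : Finset V) (ends : E → V × V) (σ c : V → ℤ) : Prop :=
  ∀ A ⊆ W, 2 ≤ A.card → A ≠ W →
    2 * k + nrm k (∑ v ∈ A, σ v) ≤ dG ends A + ∑ v ∈ A, c v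

lemma step1 {k : ℤ} {W A : Finset V} {ends : E → V × V} {ρ σ c : V → ℤ} {ex : Option V}
    (hG : Good k W ends ρ σ c ex) (ihn : IHn k W E) (hA : A ⊆ W) (h2 : 2 ≤ A.card) (hne : A ≠ W)
    (tight : dG ends A + ∑ v ∈ A, c v ≤ 2 * k - 2 + nrm k (∑ v ∈ A, σ v)) : Sol k W ends ρ := by
  obtain ⟨a, ha, hae⟩ : ∃ a ∈ A, ∀ x ∈ ex, x ≠ a := by
    obtain ⟨u, hu, w, hw, huw⟩ := one_lt_card.1 (show 1 < A.card by omega)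
    cases ex with
    | none => exact ⟨u, hu, by simp⟩
    | some x =>
      by_cases h : x = u
      · exact ⟨w, hw, by simpa [h] using huw⟩
      · exact ⟨u, hu, by simpa using h⟩
  obtain ⟨s, hs, h3, h4⟩ := contr_sol ha
    (ihn _ _ _ _ _ _ (card_cW ha hA h2) (contr_good ha hA hG h2 hae))
  refine split_sol (a := a) hs hA h3 (ihn _ _ _ _ _ _ (card_lt_card (hA.ssubset_of_ne hne))
    (inner_good ha hA hs hG.par hG.gle hG.gpar (fun x hx hxA => hG.exd x hx (hA hxA))
      (fun B hB hBn hBA hBx => hG.cut B (hB.trans hA) hBn ?_ hBx) tight h4))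
  intro h
  exact hBA (subset_antisymm hB (h ▸ hA))

lemma slack_of {k : ℤ} (hk : 0 < k) {W : Finset V} {ends : E → V × V} {ρ σ c : V → ℤ} {ex : Option V}
    (hG : Good k W ends ρ σ c ex) (ihn : IHn k W E) (hn : ¬ Sol k W ends ρ) :
    Slack k W ends σ c := by
  intro A hA h2 hne
  by_contra hlt
  apply hn
  apply step1 hG ihn hA h2 hne
  have h1 := hG.parity hA
  have h3 := nrm_par hk (∑ v ∈ A, σ v)
  omega

lemma sum_mod (B : Finset V) (σ : V → ℤ) (x y : V) (i j : ℤ) :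
    ∑ v ∈ B, (σ v + i * ind x {v} + j * ind y {v}) =
      ∑ v ∈ B, σ v + i * ind x B + j * ind y B := by
  rw [sum_add_distrib, sum_add_distrib, ← mul_sum, ← mul_sum, ← ind_sum, ← ind_sum]

lemma modif {k : ℤ} (hk : 0 < k) {W : Finset V} {ends : E → V × V} {ρ σ c : V → ℤ} {ex : Option V}
    (hG : Good k W ends ρ σ c ex) (ihm : IHm k W ends) (hsl : Slack k W ends σ c)
    {e : E} {x y : V} (hxy : x ≠ y)
    (he : ends e = (x, y) ∨ ends e = (y, x)) (i j p q : ℤ)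
    (gx : |ρ x - σ x - 1 - i| ≤ c x + p) (gy : |ρ y - σ y + 1 - j| ≤ c y + q)
    (px : (2 : ℤ) ∣ p + 1 + i) (py : (2 : ℤ) ∣ q - 1 + j)
    (tot : ∑ v ∈ W, c v + p + q ≤ 2 * k - 2 + nrm k (∑ v ∈ W, σ v + i + j))
    (hi : |i| ≤ p + 1) (hj : |j| ≤ q + 1) (hij : |i + j| ≤ p + q + 2)
    (cx : (∀ z ∈ ex, z ≠ x) → 2 * k - 2 + nrm k (σ x + i) ≤ dG ends {x} - 1 + c x + p)
    (cy : (∀ z ∈ ex, z ≠ y) → 2 * k - 2 + nrm k (σ y + j) ≤ dG ends {y} - 1 + c y + q)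
    (hex : ∀ z ∈ ex, i = 0 ∧ j = 0) : Sol k W ends ρ := by
  classical
  have hxW : x ∈ W := by rcases he with h | h <;> have := hG.onW e <;> rw [h] at this
                         · exact this.1
                         · exact this.2
  have hyW : y ∈ W := by rcases he with h | h <;> have := hG.onW e <;> rw [h] at this
                         · exact this.2
                         · exact this.1
  obtain ⟨η, hη, hinc⟩ := inc_orient he
  have hsol : Sol k W (Function.update ends e (x, x))
      (fun v => ρ v + (-1) * ind x {v} + 1 * ind y {v}) := by
    apply ihm _ _ (fun v => σ v + i * ind x {v} + j * ind y {v})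
      (fun v => c v + p * ind x {v} + q * ind y {v}) ex
    · apply nl_upd_lt; rcases he with h | h <;> rw [h]
      · exact hxy
      · exact hxy.symm
    constructor
    · exact onW_upd hG.onW e hxW hxW
    · rw [sum_mod, ind_mem hxW, ind_mem hyW]
      have := hG.rho
      simpa using this
    · intro v hv
      have h1 := hG.par v hv
      rw [bd_upd, hinc, inc_loop]
      rcases hη with h | h <;> rw [h] <;> omega
    · intro v hv
      have h1 := hG.gle v hv
      by_cases hvx : v = x
      · subst hvx
        have h2 : ind v {v} = 1 := by simp [ind]
        have h3 : ind y {v} = 0 := by simp [ind, hxy.symm]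
        rw [h2, h3]
        rw [abs_le] at gx ⊢; omega
      · have h2 : ind x {v} = 0 := by simp [ind, Ne.symm hvx]
        by_cases hvy : v = y
        · subst hvy
          have h3 : ind v {v} = 1 := by simp [ind]
          rw [h2, h3]
          rw [abs_le] at gy ⊢; omega
        · have h3 : ind y {v} = 0 := by simp [ind, Ne.symm hvy]
          rw [h2, h3]
          simpa using h1
    · intro v hv
      have h1 := hG.gpar v hv
      by_cases hvx : v = x
      · subst hvx
        have h2 : ind v {v} = 1 := by simp [ind]
        have h3 : ind y {v} = 0 := by simp [ind, hxy.symm]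
        rw [h2, h3]
        omega
      · have h2 : ind x {v} = 0 := by simp [ind, Ne.symm hvx]
        by_cases hvy : v = y
        · subst hvy
          have h3 : ind v {v} = 1 := by simp [ind]
          rw [h2, h3]
          omega
        · have h3 : ind y {v} = 0 := by simp [ind, Ne.symm hvy]
          rw [h2, h3]
          omega
    · rw [sum_mod, sum_mod, ind_mem hxW, ind_mem hyW]
      simpa using tot
    · intro A hA hne hAW hAex
      rw [sum_mod, sum_mod, dG_upd, inc_loop, hinc]
      have habs : |η * (ind x A - ind y A)| = |ind x A - ind y A| := by
        rcases hη with h | h <;> rw [h] <;> simp [abs_sub_comm]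
      rw [habs]
      by_cases hc : 2 ≤ A.card
      · have h1 := hsl A hA hc hAW
        by_cases hx : x ∈ A <;> by_cases hy : y ∈ A
        · rw [ind_mem hx, ind_mem hy]
          have := nrm_add_abs hk (∑ v ∈ A, σ v) (i + j)
          rw [← add_assoc] at this
          simp; omega
        · rw [ind_mem hx, ind_not hy]
          have := nrm_add_abs hk (∑ v ∈ A, σ v) i
          simp; omega
        · rw [ind_not hx, ind_mem hy]
          have := nrm_add_abs hk (∑ v ∈ A, σ v) j
          simp; omega
        · rw [ind_not hx, ind_not hy]
          simp; omega
      · have hc1 : A.card = 1 := by have := hne.card_pos; omega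
        obtain ⟨v, rfl⟩ := card_eq_one.1 hc1
        by_cases hvx : v = x
        · subst hvx
          have h2 : ind v {v} = 1 := by simp [ind]
          have h3 : ind y {v} = 0 := by simp [ind, hxy.symm]
          rw [h2, h3]
          have := cx (fun z hz hzv => hAex z hz (by rw [hzv]))
          simp; omega
        · have h2 : ind x {v} = 0 := by simp [ind, Ne.symm hvx]
          by_cases hvy : v = y
          · subst hvy
            have h3 : ind v {v} = 1 := by simp [ind]
            rw [h2, h3]
            have := cy (fun z hz hzv => hAex z hz (by rw [hzv]))
            simp; omega
          · have h3 : ind y {v} = 0 := by simp [ind, Ne.symm hvy]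
            rw [h2, h3]
            have := hG.cut _ hA hne hAW hAex
            simp at this ⊢; omega
    · intro z hz hzW
      have := hG.exd z hz hzW
      obtain ⟨h1, h2⟩ := hex z hz
      simpa [h1, h2] using this
  obtain ⟨s, hs, h⟩ := hsol
  refine ⟨Function.update s e η, sgn_upd hs e hη, fun v hv => ?_⟩
  have h1 := h v hv
  rw [bd_upd, inc_loop, hinc] at h1
  rw [bd_upds, hinc]
  have h2 : η * η = 1 := by rcases hη with h | h <;> rw [h] <;> norm_num
  convert h1 using 1
  linear_combination (ind x {v} - ind y {v}) * h2

lemma edge_of_inc {p : V × V} {x : V} (h : inc p {x} ≠ 0) :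
    ∃ w, w ≠ x ∧ (p = (x, w) ∨ p = (w, x)) := by
  obtain ⟨a, b⟩ := p
  by_cases ha : a = x <;> by_cases hb : b = x
  · subst ha; subst hb; simp [inc] at h
  · exact ⟨b, hb, Or.inl (by rw [ha])⟩
  · exact ⟨a, ha, Or.inr (by rw [hb])⟩
  · simp [inc, ind, ha, hb] at h

lemma lift_inc {p q : V × V} {x u w : V} (h1 : p = (x, u) ∨ p = (u, x)) (h2 : q = (x, w) ∨ q = (w, x)) :
    ∃ a b : ℤ, (a = 1 ∨ a = -1) ∧ (b = 1 ∨ b = -1) ∧ (∀ B, inc p B = a * (ind u B - ind x B)) ∧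
      (∀ B, inc q B = b * (ind x B - ind w B)) := by
  obtain ⟨a, ha, h3⟩ := inc_orient h1.symm
  obtain ⟨b, hb, h4⟩ := inc_orient h2
  exact ⟨a, b, ha, hb, h3, h4⟩

lemma lift_sol {k : ℤ} {W : Finset V} {ends : E → V × V} {ρ : V → ℤ} [DecidableEq E]
    {e1 e2 : E} {x u w : V} (hne : e1 ≠ e2)
    (h1 : ends e1 = (x, u) ∨ ends e1 = (u, x)) (h2 : ends e2 = (x, w) ∨ ends e2 = (w, x))
    (h : Sol k W (Function.update (Function.update ends e1 (u, w)) e2 (x, x)) ρ) :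
    Sol k W ends ρ := by
  obtain ⟨a, b, ha, hb, h3, h4⟩ := lift_inc h1 h2
  obtain ⟨s, hs, h⟩ := h
  have hs1 : ∀ t : ℤ, (t = 1 ∨ t = -1) → (t * s e1 = 1 ∨ t * s e1 = -1) := by
    intro t ht
    rcases ht with h | h <;> rcases hs e1 with h' | h' <;> rw [h, h'] <;> norm_num
  refine ⟨Function.update (Function.update s e1 (a * s e1)) e2 (b * s e1),
    sgn_upd (sgn_upd hs e1 (hs1 a ha)) e2 (hs1 b hb), fun v hv => ?_⟩
  have h5 := h v hv
  rw [bd_upd, bd_upd, inc_loop, Function.update_of_ne hne.symm, h3, h4] at h5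
  rw [bd_upds, bd_upds, Function.update_of_ne hne.symm, h3, h4]
  have ha2 : a * a = 1 := by rcases ha with h | h <;> rw [h] <;> norm_num
  have hb2 : b * b = 1 := by rcases hb with h | h <;> rw [h] <;> norm_num
  have h6 : inc (u, w) {v} = ind u {v} - ind w {v} := rfl
  rw [h6] at h5
  convert h5 using 1
  linear_combination s e1 * (ind u {v} - ind x {v}) * ha2 + s e1 * (ind x {v} - ind w {v}) * hb2

lemma lift_par {W : Finset V} {ends : E → V × V} {ρ : V → ℤ} [DecidableEq E]
    {e1 e2 : E} {x u w : V} (hne : e1 ≠ e2)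
    (h1 : ends e1 = (x, u) ∨ ends e1 = (u, x)) (h2 : ends e2 = (x, w) ∨ ends e2 = (w, x))
    (par : ∀ v ∈ W, (2 : ℤ) ∣ ρ v - bd ends (fun _ => 1) {v}) :
    ∀ v ∈ W, (2 : ℤ) ∣ ρ v -
      bd (Function.update (Function.update ends e1 (u, w)) e2 (x, x)) (fun _ => 1) {v} := by
  intro v hv
  obtain ⟨a, b, ha, hb, h3, h4⟩ := lift_inc h1 h2
  have := par v hv
  rw [bd_upd, bd_upd, inc_loop, Function.update_of_ne hne.symm, h3, h4]
  have h6 : inc (u, w) {v} = ind u {v} - ind w {v} := rfl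
  rw [h6]
  rcases ha with h | h <;> rcases hb with h' | h' <;> rw [h, h'] <;> omega

lemma lift_dG {ends : E → V × V} [DecidableEq E]
    {e1 e2 : E} {x u w : V} (hne : e1 ≠ e2)
    (h1 : ends e1 = (x, u) ∨ ends e1 = (u, x)) (h2 : ends e2 = (x, w) ∨ ends e2 = (w, x))
    (B : Finset V) :
    dG (Function.update (Function.update ends e1 (u, w)) e2 (x, x)) B =
      dG ends B + |ind u B - ind w B| - |ind u B - ind x B| - |ind x B - ind w B| := by
  obtain ⟨a, b, ha, hb, h3, h4⟩ := lift_inc h1 h2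
  rw [dG_upd, dG_upd, inc_loop, Function.update_of_ne hne.symm, h3, h4, abs_mul, abs_mul]
  have h6 : inc (u, w) B = ind u B - ind w B := rfl
  have h7 : |a| = 1 := by rcases ha with h | h <;> rw [h] <;> simp
  have h8 : |b| = 1 := by rcases hb with h | h <;> rw [h] <;> simp
  rw [h6, h7, h8]; simp; ring

lemma lift_onW {W : Finset V} {ends : E → V × V} [DecidableEq E] (h : OnW W ends)
    {e1 e2 : E} {x u w : V}
    (h1 : ends e1 = (x, u) ∨ ends e1 = (u, x)) (h2 : ends e2 = (x, w) ∨ ends e2 = (w, x)) :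
    OnW W (Function.update (Function.update ends e1 (u, w)) e2 (x, x)) := by
  have hu : u ∈ W ∧ x ∈ W := by
    have := h e1
    rcases h1 with h1 | h1 <;> rw [h1] at this <;> tauto
  have hw : w ∈ W := by
    have := h e2
    rcases h2 with h2 | h2 <;> rw [h2] at this <;> tauto
  exact onW_upd (onW_upd h e1 hu.1 hw) e2 hu.2 hu.2

end Core
end EqF

set_option linter.unusedSectionVars false
set_option linter.unusedVariables false

namespace EqF

section Core2
variable {V E : Type*} [DecidableEq V] [Fintype E]

lemma ends_mem {W : Finset V} {ends : E → V × V} (h : OnW W ends) {e : E} {x y : V}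
    (he : ends e = (x, y) ∨ ends e = (y, x)) : x ∈ W ∧ y ∈ W := by
  have := h e
  rcases he with he | he <;> rw [he] at this
  · exact this
  · exact this.symm

lemma ne_W {W : Finset V} {x y : V} (hx : x ∈ W) (hxy : x ≠ y) : ({y} : Finset V) ≠ W := by
  intro h
  rw [← h, mem_singleton] at hx
  exact hxy hx

lemma inc_zero_of_ne {p : V × V} {x w v : V} (h : p = (x, w) ∨ p = (w, x)) (h1 : v ≠ x) (h2 : v ≠ w) :
    inc p {v} = 0 := by
  rcases h with h | h <;> rw [h] <;> simp [inc, ind, h1.symm, h2.symm]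

lemma exc_three {k : ℤ} (hk : 2 ≤ k) {W : Finset V} {ends : E → V × V} {ρ σ c : V → ℤ} {x w : V}
    (hG : Good k W ends ρ σ c (some x)) (hx : x ∈ W) (ihn : IHn k W E) (hc : c x = 0)
    (hw : w ∈ W) (hwx : w ≠ x)
    (honly : ∀ e, inc (ends e) {x} ≠ 0 → ends e = (x, w) ∨ ends e = (w, x)) :
    Sol k W ends ρ := by
  have hA : ({x, w} : Finset V) ⊆ W := by
    intro v hv; rw [mem_insert, mem_singleton] at hv; rcases hv with rfl | rfl <;> assumption
  have h2 : 2 ≤ ({x, w} : Finset V).card := by rw [card_pair hwx.symm]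
  have ha : w ∈ ({x, w} : Finset V) := by simp
  obtain ⟨s, hs, h3, h4⟩ := contr_sol ha
    (ihn _ _ _ _ _ _ (card_cW ha hA h2) (contr_good ha hA hG h2 (by simpa using hwx.symm)))
  have hg := hG.gle x hx
  rw [hc] at hg
  have hg2 : ρ x = σ x := by
    have := abs_nonpos_iff.1 hg; omega
  have hdv := hG.exd x (by simp) hx
  have hn0 : nrm k (ρ x) = 0 := by
    rw [hg2, nrm_congr (y := 0) (by simpa using hdv), nrm_small (by omega) (by omega) (by omega)]
    simp
  have hp := par_sum hG.par (A := {x}) (by simpa using hx)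
  rw [sum_singleton] at hp
  obtain ⟨t, ht, h5, h6⟩ := star (by omega : 0 < k) ends x (ρ x) s hs hp
    (by rw [hn0]; exact dG_nonneg _ _)
  have same : ∀ B : Finset V, (∀ e, inc (ends e) {x} ≠ 0 → inc (ends e) B = 0) →
      bd ends t B = bd ends s B := by
    intro B hB
    unfold bd
    refine sum_congr rfl fun e _ => ?_
    by_cases h : inc (ends e) {x} = 0
    · rw [h5 e h]
    · rw [hB e h]; simp
  have hpair : bd ends t {x, w} = bd ends s {x, w} := by
    apply same
    intro e he
    rcases honly e he with h | h <;> rw [h] <;> simp [inc, ind]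
  have hsum : bd ends t {x, w} = bd ends t {x} + bd ends t {w} := by
    rw [bd_sum, sum_pair hwx.symm]
  rw [← hpair, hsum, sum_pair hwx.symm] at h4
  refine ⟨t, ht, fun v hv => ?_⟩
  by_cases hvx : v = x
  · rw [hvx]; exact h6
  · by_cases hvw : v = w
    · rw [hvw]
      have h7 : bd ends t {w} - ρ w = (bd ends t {x} + bd ends t {w} - (ρ x + ρ w)) -
          (bd ends t {x} - ρ x) := by ring
      rw [h7]
      exact dvd_sub h4 h6
    · rw [same {v} fun e he => inc_zero_of_ne (honly e he) hvx hvw]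
      exact h3 v (by simp [hv, hvx, hvw])

lemma exc_two {k : ℤ} (hk : 2 ≤ k) {W : Finset V} {ends : E → V × V} {ρ σ c : V → ℤ} {x u w : V}
    (hG : Good k W ends ρ σ c (some x)) (ihm : IHm k W ends) (hsl : Slack k W ends σ c)
    {e1 e2 : E} (huw : u ≠ w) (hux : u ≠ x) (hwx : w ≠ x)
    (h1 : ends e1 = (x, u) ∨ ends e1 = (u, x)) (h2 : ends e2 = (x, w) ∨ ends e2 = (w, x)) :
    Sol k W ends ρ := by
  classical
  have hne : e1 ≠ e2 := by
    rintro rfl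
    rcases h1 with h1 | h1 <;> rcases h2 with h2 | h2 <;> rw [h1] at h2 <;>
      simp only [Prod.mk.injEq] at h2 <;> tauto
  apply lift_sol hne h1 h2
  apply ihm _ _ σ c (some x)
  · have hl : nl (Function.update ends e1 (u, w)) ≤ nl ends := by
      unfold nl
      apply card_le_card
      intro f hf
      simp only [mem_filter, mem_univ, true_and] at hf ⊢
      by_cases hfe : f = e1
      · subst hfe
        rcases h1 with h1 | h1 <;> rw [h1]
        · exact hux.symm
        · exact hux
      · rwa [Function.update_of_ne hfe] at hf
    refine lt_of_lt_of_le (nl_upd_lt _ _ _ ?_) hl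
    rw [Function.update_of_ne hne.symm]
    rcases h2 with h2 | h2 <;> rw [h2]
    · exact hwx.symm
    · exact hwx
  refine ⟨lift_onW hG.onW h1 h2, hG.rho, lift_par hne h1 h2 hG.par, hG.gle, hG.gpar, hG.tot, ?_, hG.exd⟩
  intro A hA hAne hAW hAx
  rw [lift_dG hne h1 h2]
  have hcut := hG.cut A hA hAne hAW hAx
  by_cases hc : 2 ≤ A.card
  · have := hsl A hA hc hAW
    unfold ind
    split_ifs <;> simp <;> omega
  · have hc1 : A.card = 1 := by have := hAne.card_pos; omega
    obtain ⟨v, rfl⟩ := card_eq_one.1 hc1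
    have hvx : x ≠ v := fun h => hAx x (by simp) (by rw [h])
    have hx0 : ind x {v} = 0 := by simp [ind, hvx]
    rw [hx0]
    by_cases hu : u = v
    · have hwv : w ≠ v := fun h => huw (hu.trans h.symm)
      simp [ind, hu, hwv] at *; omega
    · by_cases hwv : w = v
      · simp [ind, hu, hwv] at *; omega
      · simp [ind, hu, hwv] at *; omega

lemma exc {k : ℤ} (hk : 2 ≤ k) {W : Finset V} {ends : E → V × V} {ρ σ c : V → ℤ} {x : V}
    (hG : Good k W ends ρ σ c (some x)) (hx : x ∈ W) (ihn : IHn k W E) (ihm : IHm k W ends)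
    (hsl : Slack k W ends σ c) (hW : 2 ≤ W.card) : Sol k W ends ρ := by
  have hk0 : 0 < k := by omega
  obtain ⟨w0, hw0, hw0x⟩ : ∃ w ∈ W, w ≠ x := exists_mem_ne (by omega) x
  have hdv := hG.exd x (by simp) hx
  have hd : c x ≤ dG ends {x} := by
    have h1 := hG.cut (W \ {x}) sdiff_subset ⟨w0, by simp [hw0, hw0x]⟩
      (fun h => by have : x ∈ W \ {x} := by rw [h]; exact hx
                   simp at this)
      (fun y hy h => by
        simp only [Option.mem_def, Option.some.injEq] at hy
        subst hy
        have : x ∈ W \ {x} := by rw [h]; simp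
        simp at this)
    rw [dG_compl hG.onW] at h1
    have h2 := hG.tot
    have h3 := sum_sdiff (f := c) (show {x} ⊆ W by simpa using hx)
    have h4 := sum_sdiff (f := σ) (show {x} ⊆ W by simpa using hx)
    rw [sum_singleton] at h3 h4
    have h5 : nrm k (∑ v ∈ W \ {x}, σ v) = nrm k (∑ v ∈ W, σ v) := by
      apply nrm_congr
      rw [← h4, sub_add_cancel_left]
      exact (Int.dvd_neg).2 hdv
    omega
  have hg := hG.gle x hx
  have hgp := hG.gpar x hx
  by_cases hc : c x = 0
  · by_cases hex : ∃ e1 e2 u w, u ≠ w ∧ u ≠ x ∧ w ≠ x ∧ (ends e1 = (x, u) ∨ ends e1 = (u, x)) ∧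
        (ends e2 = (x, w) ∨ ends e2 = (w, x))
    · obtain ⟨e1, e2, u, w, h1, h2, h3, h4, h5⟩ := hex
      exact exc_two hk hG ihm hsl h1 h2 h3 h4 h5
    · by_cases hE : ∃ e, inc (ends e) {x} ≠ 0
      · obtain ⟨e, he⟩ := hE
        obtain ⟨w, hwx, hw⟩ := edge_of_inc he
        refine exc_three hk hG hx ihn hc (ends_mem hG.onW hw).2 hwx fun f hf => ?_
        obtain ⟨u, hux, hu⟩ := edge_of_inc hf
        by_cases huw : u = w
        · rw [← huw]; exact hu
        · exact (hex ⟨f, e, u, w, huw, hux, hwx, hu, hw⟩).elim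
      · push Not at hE
        exact exc_three hk hG hx ihn hc hw0 hw0x fun f hf => (hf (hE f)).elim
  · have hc0 : 0 < c x := by have := abs_nonneg (ρ x - σ x); omega
    obtain ⟨e, he⟩ := exists_cross (show 0 < dG ends {x} by omega)
    obtain ⟨w, hwx, hw⟩ := edge_of_inc he
    have hwW := (ends_mem hG.onW hw).2
    have hcw := hG.cut {w} (by simpa using hwW) (by simp) (ne_W hx hwx.symm) (by
      intro y hy; simp only [Option.mem_def, Option.some.injEq] at hy; subst hy; simpa using hwx)
    rw [sum_singleton, sum_singleton] at hcw
    have htot := hG.tot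
    have hgw := hG.gle w hwW
    rw [abs_le] at hg hgw
    by_cases hgx : -c x < ρ x - σ x
    · apply modif hk0 hG ihm hsl hwx.symm hw 0 0 (-1) 1
      · rw [abs_le]; omega
      · rw [abs_le]; omega
      · norm_num
      · norm_num
      · simpa using htot
      · norm_num
      · norm_num
      · norm_num
      · intro h; exact (h x (by simp) rfl).elim
      · intro _; rw [add_zero]; omega
      · simp
    · apply modif hk0 hG ihm hsl hwx hw.symm 0 0 1 (-1)
      · rw [abs_le]; omega
      · rw [abs_le]; omega
      · norm_num
      · norm_num
      · simpa using htot
      · norm_num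
      · norm_num
      · norm_num
      · intro _; rw [add_zero]; omega
      · intro h; exact (h x (by simp) rfl).elim
      · simp

end Core2
end EqF

set_option linter.unusedSectionVars false
set_option linter.unusedVariables false

namespace EqF

section Core3
variable {V E : Type*} [DecidableEq V] [Fintype E]

/-- all vertices refuse an increase of `σ` -/
lemma main_down {k : ℤ} (hk : 2 ≤ k) {W : Finset V} {ends : E → V × V} {ρ σ c : V → ℤ}
    (hG : Good k W ends ρ σ c none) (ihm : IHm k W ends) (ihl : IHl k W ends c)
    (hsl : Slack k W ends σ c) {e : E} {x y : V} (hxy : x ≠ y)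
    (he : ends e = (x, y) ∨ ends e = (y, x))
    (full : 2 * k - 2 + nrm k (∑ v ∈ W, σ v) ≤ ∑ v ∈ W, c v)
    (hm : ∀ v ∈ W, 2 * k - 2 + nrm k (σ v - 1) ≤ dG ends {v} + c v - 1)
    (hp : ∀ v ∈ W, ¬ (2 * k - 2 + nrm k (σ v + 1) ≤ dG ends {v} + c v - 1)) :
    Sol k W ends ρ := by
  have hk0 : 0 < k := by omega
  have htot := hG.tot
  obtain ⟨hxW, hyW⟩ := ends_mem hG.onW he
  have hcs : ∀ v ∈ W, 2 * k - 2 + nrm k (σ v) ≤ dG ends {v} + c v := by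
    intro v hv
    have h1 := hG.cut {v} (by simpa using hv) (by simp) (by
      by_cases h : x = v
      · exact ne_W hyW (h ▸ hxy.symm)
      · exact ne_W hxW h) (by simp)
    rwa [sum_singleton, sum_singleton] at h1
  have hgx := hG.gle x hxW
  have hgy := hG.gle y hyW
  rw [abs_le] at hgx hgy
  have hst := nrm_step hk (∑ v ∈ W, σ v)
  by_cases hup : nrm k (∑ v ∈ W, σ v - 1) = nrm k (∑ v ∈ W, σ v) + 1
  · have h1 := hm y hyW
    have h2 := hcs x hxW
    apply modif hk0 hG ihm hsl hxy.symm he.symm (-1) 0 0 1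
    · rw [abs_le]; omega
    · rw [abs_le]; omega
    · norm_num
    · norm_num
    · rw [add_zero, add_zero, ← sub_eq_add_neg]; omega
    · norm_num
    · norm_num
    · norm_num
    · intro _; rw [← sub_eq_add_neg]; omega
    · intro _; rw [add_zero]; omega
    · simp
  · have hdn : nrm k (∑ v ∈ W, σ v - 1) = nrm k (∑ v ∈ W, σ v) - 1 := by omega
    by_cases hdef : ∃ v ∈ W, ρ v - σ v < c v
    · obtain ⟨v, hv, hvg⟩ := hdef
      have hgv := hG.gle v hv
      have hgpv := hG.gpar v hv
      rw [abs_le] at hgv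
      have hsum : ∀ (f : V → ℤ) (B : Finset V), ∑ u ∈ B, (f u - ind v {u}) = ∑ u ∈ B, f u - ind v B := by
        intro f B; rw [sum_sub_distrib, ← ind_sum]
      apply ihl ρ (fun u => σ u - ind v {u}) (fun u => c u - ind v {u}) none
      · rw [hsum, ind_mem hv]
        have : c v ≤ ∑ u ∈ W, c u :=
          single_le_sum (f := c) (fun u hu => (abs_nonneg _).trans (hG.gle u hu)) hv
        omega
      refine ⟨hG.onW, hG.rho, hG.par, ?_, ?_, ?_, ?_, by simp⟩
      · intro u hu
        by_cases h : u = v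
        · subst h
          have : ind u {u} = 1 := by simp [ind]
          rw [this, abs_le]; omega
        · have : ind v {u} = 0 := by simp [ind, Ne.symm h]
          rw [this]; simpa using hG.gle u hu
      · intro u hu
        have := hG.gpar u hu
        omega
      · rw [hsum, hsum, ind_mem hv]; omega
      · intro A hA hne hAW _
        rw [hsum, hsum]
        by_cases hvA : v ∈ A
        · rw [ind_mem hvA]
          by_cases hc : 2 ≤ A.card
          · have h1 := hsl A hA hc hAW
            have h2 := nrm_add_abs hk0 (∑ u ∈ A, σ u) (-1)
            rw [← sub_eq_add_neg] at h2
            norm_num at h2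
            omega
          · obtain ⟨u, hu⟩ := card_eq_one.1 (show A.card = 1 by have := hne.card_pos; omega)
            subst hu
            rw [mem_singleton] at hvA
            subst hvA
            have := hm v hv
            simp only [sum_singleton]; omega
        · rw [ind_not hvA, sub_zero, sub_zero]
          exact hG.cut A hA hne hAW (by simp)
    · push Not at hdef
      have hgc : ∀ v ∈ W, ρ v = σ v + c v := by
        intro v hv
        have h1 := hdef v hv
        have h2 := hG.gle v hv
        rw [abs_le] at h2
        omega
      have hsum : ∑ v ∈ W, ρ v = ∑ v ∈ W, σ v + ∑ v ∈ W, c v := by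
        rw [← sum_add_distrib]; exact sum_congr rfl hgc
      have hrho := hG.rho
      rw [hsum] at hrho
      generalize hS : ∑ v ∈ W, σ v = S at *
      generalize hC : ∑ v ∈ W, c v = C at *
      have hCe : C = 2 * k - 2 + nrm k S := by omega
      have hS1 : 2 * k ∣ S - 1 ∧ nrm k S = 1 := by
        obtain ⟨a, n, h0, h1, h2, h3⟩ := nrm_rep hk0 S
        have ha : 0 < a := by
          by_contra hneg
          have hh : nrm k (S - 1) = nrm k (a - 1) := nrm_congr ⟨n, by rw [h0]; ring⟩
          rw [nrm_small hk0 (x := a - 1) (by omega) (by omega), abs_of_neg (show a - 1 < 0 by omega)] at hh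
          rw [h3, abs_of_nonpos (by omega)] at hdn
          omega
        rw [abs_of_pos ha] at h3
        have h4 : 2 * k ∣ 2 * (a - 1) := by
          have h5 : 2 * (a - 1) = S + C - 2 * k * (n + 1) := by
            rw [hCe, h3, h0]; ring
          rw [h5]; exact dvd_sub hrho ⟨n + 1, rfl⟩
        have h6 : k ∣ a - 1 := Int.dvd_of_mul_dvd_mul_left (by norm_num) h4
        have h7 : a - 1 = 0 := Int.eq_zero_of_dvd_of_nonneg_of_lt (by omega) (by omega) h6
        exact ⟨⟨n, by rw [h0]; linear_combination h7⟩, by omega⟩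
      obtain ⟨hSd, hSn⟩ := hS1
      have hy1 := hm y hyW
      have hy2 := hp y hyW
      have hy3 := hcs y hyW
      have hy4 := nrm_step hk (σ y)
      have hpar := hG.parity (A := {y}) (by simpa using hyW)
      rw [sum_singleton, sum_singleton] at hpar
      have hpar2 := nrm_par hk0 (σ y)
      obtain ⟨ht0, htk, _, _, htd⟩ : 0 < nrm k (σ y) ∧ nrm k (σ y) < k ∧ nrm k (σ y + 1) = nrm k (σ y) + 1
          ∧ nrm k (σ y - 1) = nrm k (σ y) - 1 ∧ 2 * k ∣ σ y - nrm k (σ y) := by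
        rcases hy4 with h | h | h | h
        · omega
        · omega
        · exact h
        · omega
      generalize ht : nrm k (σ y) = t at *
      have hx1 := hm x hxW
      apply modif hk0 hG ihm hsl hxy he (-1) (k - t + 1) 0 (k - t)
      · rw [abs_le]; omega
      · rw [abs_le]; omega
      · norm_num
      · exact ⟨k - t, by ring⟩
      · rw [hS, hC, nrm_congr (y := k - t + 1), nrm_small hk0 (by omega) (by omega), abs_of_pos (by omega)]
        · omega
        · have : S + -1 + (k - t + 1) - (k - t + 1) = S - 1 := by ring
          rw [this]; exact hSd
      · norm_num
      · rw [abs_of_pos (by omega)]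
      · rw [abs_of_pos (by omega)]; omega
      · intro _; rw [← sub_eq_add_neg]; omega
      · intro _
        have : nrm k (σ y + (k - t + 1)) = nrm k (1 - k) := by
          apply nrm_congr
          have : σ y + (k - t + 1) - (1 - k) = (σ y - t) + 2 * k := by ring
          rw [this]; exact dvd_add htd (dvd_refl _)
        rw [this, nrm_small hk0 (by omega) (by omega), abs_of_neg (by omega)]
        omega
      · simp

lemma good_neg {k : ℤ} (hk : 0 < k) {W : Finset V} {ends : E → V × V} {ρ σ c : V → ℤ} {ex : Option V}
    (hG : Good k W ends ρ σ c ex) :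
    Good k W ends (fun v => - ρ v) (fun v => - σ v) c ex := by
  refine ⟨hG.onW, ?_, ?_, ?_, ?_, ?_, ?_, ?_⟩
  · rw [sum_neg_distrib]; exact (Int.dvd_neg).2 hG.rho
  · intro v hv; have := hG.par v hv; omega
  · intro v hv; have := hG.gle v hv; rw [abs_le] at *; omega
  · intro v hv; have := hG.gpar v hv; omega
  · rw [sum_neg_distrib, nrm_neg hk]; exact hG.tot
  · intro A h1 h2 h3 h4
    rw [sum_neg_distrib, nrm_neg hk]; exact hG.cut A h1 h2 h3 h4
  · intro x hx hxW; exact (Int.dvd_neg).2 (hG.exd x hx hxW)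

lemma sol_neg {k : ℤ} {W : Finset V} {ends : E → V × V} {ρ : V → ℤ}
    (h : Sol k W ends (fun v => - ρ v)) : Sol k W ends ρ := by
  obtain ⟨s, hs, h⟩ := h
  refine ⟨fun e => - s e, ?_, ?_⟩
  · intro e; rcases hs e with h | h <;> simp [h]
  · intro v hv
    have h1 := h v hv
    have : bd ends (fun e => - s e) {v} - ρ v = - (bd ends s {v} - - ρ v) := by
      unfold bd; simp only [neg_mul, sum_neg_distrib]; ring
    rw [this]; exact (Int.dvd_neg).2 h1

lemma main_none {k : ℤ} (hk : 2 ≤ k) {W : Finset V} {ends : E → V × V} {ρ σ c : V → ℤ}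
    (hG : Good k W ends ρ σ c none) (ihn : IHn k W E) (ihm : IHm k W ends) (ihl : IHl k W ends c)
    (hsl : Slack k W ends σ c) (hW : 2 ≤ W.card) : Sol k W ends ρ := by
  classical
  have hk0 : 0 < k := by omega
  have htot := hG.tot
  have hneW : ∀ v ∈ W, ({v} : Finset V) ≠ W := fun v _ h => by
    rw [← h, card_singleton] at hW; omega
  have hcs : ∀ v ∈ W, 2 * k - 2 + nrm k (σ v) ≤ dG ends {v} + c v := by
    intro v hv
    have h1 := hG.cut {v} (by simpa using hv) (by simp) (hneW v hv) (by simp)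
    rwa [sum_singleton, sum_singleton] at h1
  have hps : ∀ v ∈ W, (2 : ℤ) ∣ dG ends {v} + c v - σ v := by
    intro v hv
    have h1 := hG.parity (A := {v}) (by simpa using hv)
    rwa [sum_singleton, sum_singleton] at h1
  by_cases hD : ∃ v ∈ W, ¬ (2 * k - 2 + nrm k (σ v - 1) ≤ dG ends {v} + c v - 1) ∧
      ¬ (2 * k - 2 + nrm k (σ v + 1) ≤ dG ends {v} + c v - 1)
  · obtain ⟨v, hv, h1, h2⟩ := hD
    have h3 := hcs v hv
    have h4 := nrm_step hk (σ v)
    have h5 := hps v hv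
    have h6 := nrm_par hk0 (σ v)
    have h7 : nrm k (σ v) = 0 := by omega
    have h8 := nrm_zero_dvd hk0 h7
    refine exc hk (x := v) (σ := σ) (c := c) ⟨hG.onW, hG.rho, hG.par, hG.gle, hG.gpar, hG.tot,
      fun A a1 a2 a3 _ => hG.cut A a1 a2 a3 (by simp), ?_⟩ hv ihn ihm hsl hW
    intro x hx _
    simp only [Option.mem_def, Option.some.injEq] at hx
    subst hx; exact h8
  have hD' : ∀ v ∈ W, (2 * k - 2 + nrm k (σ v - 1) ≤ dG ends {v} + c v - 1) ∨
      (2 * k - 2 + nrm k (σ v + 1) ≤ dG ends {v} + c v - 1) := by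
    intro v hv
    by_contra h
    exact hD ⟨v, hv, not_or.1 h⟩
  have hcon : ∀ A ⊆ W, A.Nonempty → A ≠ W → 0 < dG ends A := by
    intro A h1 h2 h3
    by_contra h4
    have h5 := hG.cut A h1 h2 h3 (by simp)
    have h6 := hG.cut (W \ A) sdiff_subset
      (sdiff_nonempty.2 fun h => h3 (subset_antisymm h1 h))
      (fun h => by
        obtain ⟨a, ha⟩ := h2
        have : a ∈ W \ A := by rw [h]; exact h1 ha
        exact (mem_sdiff.1 this).2 ha) (by simp)
    rw [dG_compl hG.onW] at h6
    have h7 := sum_sdiff (f := c) h1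
    have h8 := sum_sdiff (f := σ) h1
    have h9 := nrm_add hk0 (∑ v ∈ W \ A, σ v) (∑ v ∈ A, σ v)
    rw [h8] at h9
    omega
  -- crossing edges with named ends
  have hcross : ∀ A ⊆ W, A.Nonempty → A ≠ W → ∃ e x y, x ∈ A ∧ y ∈ W ∧ y ∉ A ∧
      (ends e = (x, y) ∨ ends e = (y, x)) := by
    intro A h1 h2 h3
    obtain ⟨e, he⟩ := exists_cross (hcon A h1 h2 h3)
    have := hG.onW e
    by_cases ha : (ends e).1 ∈ A <;> by_cases hb : (ends e).2 ∈ A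
    · simp [inc, ind, ha, hb] at he
    · exact ⟨e, _, _, ha, this.2, hb, Or.inl rfl⟩
    · exact ⟨e, _, _, hb, this.1, ha, Or.inr rfl⟩
    · simp [inc, ind, ha, hb] at he
  obtain ⟨w0, hw0⟩ : W.Nonempty := card_pos.1 (by omega)
  obtain ⟨e0, x0, y0, hx0, hy0, hxy0, he0⟩ := hcross {w0} (by simpa using hw0) (by simp) (hneW _ hw0)
  have hx0W : x0 ∈ W := by rw [mem_singleton] at hx0; rw [hx0]; exact hw0
  have hne0 : x0 ≠ y0 := fun h => hxy0 (h ▸ hx0)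
  by_cases full : 2 * k - 2 + nrm k (∑ v ∈ W, σ v) ≤ ∑ v ∈ W, c v
  swap
  · have h1 := hG.parity (subset_refl W)
    have h2 : dG ends W = 0 := by
      unfold dG
      refine sum_eq_zero fun e _ => ?_
      simp [inc, ind, (hG.onW e).1, (hG.onW e).2]
    have h3 := nrm_par hk0 (∑ v ∈ W, σ v)
    have hgx := hG.gle x0 hx0W
    have hgy := hG.gle y0 hy0
    have hcx := hcs x0 hx0W
    have hcy := hcs y0 hy0
    rw [abs_le] at hgx hgy
    apply modif hk0 hG ihm hsl hne0 he0 0 0 1 1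
    · rw [abs_le]; omega
    · rw [abs_le]; omega
    · norm_num
    · norm_num
    · rw [add_zero, add_zero]; omega
    · norm_num
    · norm_num
    · norm_num
    · intro _; rw [add_zero]; omega
    · intro _; rw [add_zero]; omega
    · simp
  have halpha : ∀ e x y, x ≠ y → (ends e = (x, y) ∨ ends e = (y, x)) →
      (2 * k - 2 + nrm k (σ x - 1) ≤ dG ends {x} + c x - 1) →
      (2 * k - 2 + nrm k (σ y + 1) ≤ dG ends {y} + c y - 1) → Sol k W ends ρ := by
    intro e x y hxy he h1 h2
    obtain ⟨hxW, hyW⟩ := ends_mem hG.onW he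
    have hgx := hG.gle x hxW
    have hgy := hG.gle y hyW
    rw [abs_le] at hgx hgy
    apply modif hk0 hG ihm hsl hxy he (-1) 1 0 0
    · rw [abs_le]; omega
    · rw [abs_le]; omega
    · norm_num
    · norm_num
    · simpa using htot
    · norm_num
    · norm_num
    · norm_num
    · intro _; rw [← sub_eq_add_neg]; omega
    · intro _; omega
    · simp
  by_cases hup : ∀ v ∈ W, ¬ (2 * k - 2 + nrm k (σ v + 1) ≤ dG ends {v} + c v - 1)
  · exact main_down hk hG ihm ihl hsl hne0 he0 full
      (fun v hv => (hD' v hv).resolve_right (hup v hv)) hup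
  by_cases hdn : ∀ v ∈ W, ¬ (2 * k - 2 + nrm k (σ v - 1) ≤ dG ends {v} + c v - 1)
  · apply sol_neg
    have e1 : ∀ x : ℤ, nrm k (- x - 1) = nrm k (x + 1) := fun x => by
      rw [← nrm_neg hk0]; congr 1; ring
    have e2 : ∀ x : ℤ, nrm k (- x + 1) = nrm k (x - 1) := fun x => by
      rw [← nrm_neg hk0]; congr 1; ring
    refine main_down hk (good_neg hk0 hG) ihm ihl ?_ hne0 he0 ?_ ?_ ?_
    · intro A h1 h2 h3
      rw [sum_neg_distrib, nrm_neg hk0]; exact hsl A h1 h2 h3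
    · rw [sum_neg_distrib, nrm_neg hk0]; exact full
    · intro v hv; rw [e1]; exact (hD' v hv).resolve_left (hdn v hv)
    · intro v hv; rw [e2]; exact hdn v hv
  push Not at hup hdn
  obtain ⟨u, huW, hu⟩ := hup
  obtain ⟨w, hwW, hw⟩ := hdn
  by_cases hall : ∀ v ∈ W, (2 * k - 2 + nrm k (σ v + 1) ≤ dG ends {v} + c v - 1)
  · obtain ⟨e, x, y, hx, hy, hxy, he⟩ := hcross {w} (by simpa using hwW) (by simp) (hneW _ hwW)
    rw [mem_singleton] at hx
    subst hx
    exact halpha e x y (fun h => hxy (by simp [h])) he hw (hall y hy)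
  · have hne : W.filter (fun v => 2 * k - 2 + nrm k (σ v + 1) ≤ dG ends {v} + c v - 1) ≠ W := by
      intro h; exact hall (filter_eq_self.1 h)
    obtain ⟨e, x, y, hx, hy, hxy, he⟩ := hcross _ (filter_subset _ W)
      ⟨u, mem_filter.2 ⟨huW, hu⟩⟩ hne
    rw [mem_filter] at hx
    have hy2 : ¬ (2 * k - 2 + nrm k (σ y + 1) ≤ dG ends {y} + c y - 1) :=
      fun h => hxy (mem_filter.2 ⟨hy, h⟩)
    exact halpha e y x (fun h => hy2 (h ▸ hx.2)) he.symm ((hD' y hy).resolve_right hy2) hx.2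

lemma core_step {k : ℤ} (hk : 2 ≤ k) {W : Finset V} {ends : E → V × V} {ρ σ c : V → ℤ}
    {ex : Option V}
    (hG : Good k W ends ρ σ c ex) (ihn : IHn k W E) (ihm : IHm k W ends) (ihl : IHl k W ends c) :
    Sol k W ends ρ := by
  by_cases hW : 2 ≤ W.card
  · by_contra hn
    have hsl := slack_of (by omega) hG ihn hn
    apply hn
    cases ex with
    | none => exact main_none hk hG ihn ihm ihl hsl hW
    | some x =>
      by_cases hx : x ∈ W
      · exact exc hk hG hx ihn ihm hsl hW
      · refine main_none hk (σ := σ) (c := c) ⟨hG.onW, hG.rho, hG.par, hG.gle, hG.gpar, hG.tot,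
          fun A a1 a2 a3 _ => hG.cut A a1 a2 a3 ?_, by simp⟩ ihn ihm ihl hsl hW
        intro y hy h
        simp only [Option.mem_def, Option.some.injEq] at hy
        subst hy
        exact hx (a1 (by rw [h]; simp))
  · refine ⟨fun _ => 1, sgn_one, fun v hv => ?_⟩
    have h1 : W = {v} := by
      obtain ⟨u, hu⟩ := card_eq_one.1 (show W.card = 1 by have := card_pos.2 ⟨v, hv⟩; omega)
      rw [hu, mem_singleton] at hv
      rw [hu, hv]
    have h2 := hG.rho
    have h3 := bd_W hG.onW (fun _ => 1)
    rw [h1] at h2 h3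
    rw [sum_singleton] at h2
    rw [h3, zero_sub]
    exact (Int.dvd_neg).2 h2

theorem core {k : ℤ} (hk : 2 ≤ k) : ∀ (n m l : ℕ) (W : Finset V) (ends : E → V × V)
    (ρ σ c : V → ℤ) (ex : Option V), W.card = n → nl ends = m → (∑ v ∈ W, c v).toNat = l →
    Good k W ends ρ σ c ex → Sol k W ends ρ := by
  intro n
  induction n using Nat.strong_induction_on with
  | _ n ihn =>
  intro m
  induction m using Nat.strong_induction_on with
  | _ m ihm =>
  intro l
  induction l using Nat.strong_induction_on with
  | _ l ihl =>
  intro W ends ρ σ c ex hn hm hl hG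
  subst hn; subst hm; subst hl
  apply core_step hk hG
  · intro W' ends' ρ' σ' c' ex' h hG'
    exact ihn _ h _ _ W' ends' ρ' σ' c' ex' rfl rfl rfl hG'
  · intro ends' ρ' σ' c' ex' h hG'
    exact ihm _ h _ W ends' ρ' σ' c' ex' rfl rfl rfl hG'
  · intro ρ' σ' c' ex' h hG'
    exact ihl _ h W ends ρ' σ' c' ex' rfl rfl rfl hG'

end Core3
end EqF

set_option linter.unusedSectionVars false
set_option linter.unusedVariables false

namespace EqF

section Tree
variable {V E : Type*} [DecidableEq V] [Fintype E]

lemma inc_ne {p : V × V} {B : Finset V} : inc p B ≠ 0 ↔ ¬ (p.1 ∈ B ↔ p.2 ∈ B) := by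
  unfold inc ind; split_ifs <;> simp_all

lemma cross_iff {p : V × V} {x y : V} (h : p = (x, y) ∨ p = (y, x)) {B : Finset V} :
    inc p B ≠ 0 ↔ ¬ (x ∈ B ↔ y ∈ B) := by
  rw [inc_ne]; rcases h with h | h <;> rw [h] <;> tauto

/-- `T` crosses all cuts of `W` -/
def Cr (W : Finset V) (ends : E → V × V) (T : Finset E) : Prop :=
  ∀ X ⊆ W, X.Nonempty → X ≠ W → ∃ e ∈ T, inc (ends e) X ≠ 0

/-- number of edges of `T` at `v` -/
def dv (ends : E → V × V) (T : Finset E) (v : V) : ℤ := ∑ e ∈ T, |inc (ends e) {v}|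

lemma abs_inc_eq {p : V × V} {B : Finset V} (h : inc p B ≠ 0) : |inc p B| = 1 := by
  rcases inc_cases p B with h1 | h1 | h1
  · exact (h h1).elim
  · rw [h1]; simp
  · rw [h1]; simp

lemma nobad {k : ℤ} (hk : 2 ≤ k) {W : Finset V} {ends : E → V × V} {ρ : V → ℤ}
    (hW : OnW W ends) (rho : 2 * k ∣ ∑ v ∈ W, ρ v)
    (par : ∀ v ∈ W, (2 : ℤ) ∣ ρ v - bd ends (fun _ => 1) {v})
    (cut : ∀ A ⊆ W, A.Nonempty → A ≠ W → 2 * k - 2 + nrm k (∑ v ∈ A, ρ v) ≤ dG ends A) :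
    Sol k W ends ρ := by
  refine core hk _ _ _ W ends ρ ρ (fun _ => 0) none rfl rfl rfl ⟨hW, rho, par, ?_, ?_, ?_, ?_, ?_⟩
  · intro v _; simp
  · intro v _; simp
  · have := nrm_nonneg (by omega : 0 < k) (∑ v ∈ W, ρ v)
    simp only [sum_const_zero]; omega
  · intro A h1 h2 h3 _
    simpa using cut A h1 h2 h3
  · simp

lemma ec_sol {k : ℤ} (hk : 2 ≤ k) {W : Finset V} {ends : E → V × V} {ρ : V → ℤ}
    (hW : OnW W ends) (rho : 2 * k ∣ ∑ v ∈ W, ρ v)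
    (par : ∀ v ∈ W, (2 : ℤ) ∣ ρ v - bd ends (fun _ => 1) {v})
    (hc : ∀ A ⊆ W, A.Nonempty → A ≠ W → 3 * k - 3 ≤ dG ends A) :
    Sol k W ends ρ := by
  refine nobad hk hW rho par fun A h1 h2 h3 => ?_
  have h4 := hc A h1 h2 h3
  have h5 := par_sum par h1
  have h6 := nrm_par (by omega : 0 < k) (∑ v ∈ A, ρ v)
  have h7 := nrm_le (by omega : 0 < k) (∑ v ∈ A, ρ v)
  omega

/-- `T` crosses, away from `v`, all cuts of `W` minus `v` -/
def CrI (W : Finset V) (v : V) (ends : E → V × V) (T : Finset E) : Prop :=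
  ∀ X ⊆ W \ {v}, X.Nonempty → X ≠ W \ {v} →
    ∃ e ∈ T, isIn (W \ {v}) (ends e) ∧ inc (ends e) X ≠ 0

/-- induction hypothesis for the tree case -/
def IHt (k : ℤ) (W : Finset V) (m : ℕ) (E : Type*) [Fintype E] : Prop :=
  ∀ (W' : Finset V) (ends : E → V × V) (ρ : V → ℤ) (T : Fin m → Finset E), W'.card < W.card →
    OnW W' ends → 2 * k ∣ ∑ v ∈ W', ρ v →
    (∀ v ∈ W', (2 : ℤ) ∣ ρ v - bd ends (fun _ => 1) {v}) →
    (∀ i j, i ≠ j → Disjoint (T i) (T j)) → (∀ i, Cr W' ends (T i)) → Sol k W' ends ρ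

lemma tl_empty {k : ℤ} (hk : 2 ≤ k) {m : ℕ} {W : Finset V} {ends : E → V × V} {ρ : V → ℤ} {v : V}
    (hv : v ∈ W) (hW2 : 2 ≤ W.card) (ih : IHt k W m E)
    (hW : OnW W ends) (rho : 2 * k ∣ ∑ v ∈ W, ρ v)
    (par : ∀ v ∈ W, (2 : ℤ) ∣ ρ v - bd ends (fun _ => 1) {v})
    (T : Fin m → Finset E) (hT : ∀ i j, i ≠ j → Disjoint (T i) (T j))
    (hI : ∀ i, CrI W v ends (T i)) (hd : k ≤ dG ends {v}) : Sol k W ends ρ := by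
  have hp := par_sum par (A := {v}) (by simpa using hv)
  rw [sum_singleton] at hp
  obtain ⟨s, hs, _, h6⟩ := star (by omega : 0 < k) ends v (ρ v) (fun _ => 1) sgn_one hp
    ((nrm_le (by omega) _).trans hd)
  obtain ⟨a, haW, hav⟩ : ∃ w ∈ W, w ≠ v := exists_mem_ne (by omega) v
  have ha : a ∈ W \ {v} := by simp [haW, hav]
  have hsub : ({v} : Finset V) ⊆ W := by simpa using hv
  refine split_sol (A := W \ {v}) (a := a) hs sdiff_subset ?_ ?_
  · intro u hu
    rw [Finset.sdiff_sdiff_eq_self hsub, mem_singleton] at hu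
    rw [hu]; exact h6
  · refine ih _ _ _ T (card_lt_card (sdiff_ssubset hsub (by simp))) (onW_iE ha ends) (iE_rho ?_)
      (iE_par hs sdiff_subset a par) hT ?_
    · have h1 := sum_sdiff (f := ρ) hsub
      have h2 := sum_sdiff (f := fun u => bd ends s {u}) hsub
      rw [← bd_sum, ← bd_sum, ← bd_sum, bd_W hW] at h2
      rw [sum_singleton] at h1
      have h3 : bd ends s (W \ {v}) - ∑ v ∈ W \ {v}, ρ v =
          - (bd ends s {v} - ρ v) - ∑ u ∈ W, ρ u := by linarith
      rw [h3]
      exact dvd_sub ((Int.dvd_neg).2 h6) rho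
    · intro i X hX hne hXW
      obtain ⟨e, he, hin, hc⟩ := hI i X hX hne hXW
      refine ⟨e, he, ?_⟩
      unfold iE; rw [if_pos hin]; exact hc

lemma dv_two {ends : E → V × V} {T : Finset E} {v : V} {e f : E} (he : e ∈ T) (hf : f ∈ T)
    (hne : e ≠ f) (h1 : inc (ends e) {v} ≠ 0) (h2 : inc (ends f) {v} ≠ 0) : 2 ≤ dv ends T v := by
  classical
  have hsub : ({e, f} : Finset E) ⊆ T := by
    intro x hx; rw [mem_insert, mem_singleton] at hx; rcases hx with rfl | rfl <;> assumption
  have := sum_le_sum_of_subset_of_nonneg (f := fun e => |inc (ends e) {v}|) hsub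
    (fun _ _ _ => abs_nonneg _)
  rw [sum_pair hne, abs_inc_eq h1, abs_inc_eq h2] at this
  unfold dv; linarith

lemma dv_one {ends : E → V × V} {T : Finset E} {v : V} {e : E} (he : e ∈ T)
    (h1 : inc (ends e) {v} ≠ 0) : 1 ≤ dv ends T v := by
  have := single_le_sum (f := fun e => |inc (ends e) {v}|) (s := T) (fun _ _ => abs_nonneg _) he
  rw [abs_inc_eq h1] at this
  exact this

lemma dv_exists {ends : E → V × V} {T : Finset E} {v : V} (h : dv ends T v ≠ 0) :
    ∃ e ∈ T, inc (ends e) {v} ≠ 0 := by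
  by_contra! hh
  exact h (sum_eq_zero fun e he => by rw [hh e he, abs_zero])

lemma dv_erase [DecidableEq E] {ends : E → V × V} {T : Finset E} {v : V} {e : E} (he : e ∈ T)
    (h1 : inc (ends e) {v} ≠ 0) : dv ends (T.erase e) v = dv ends T v - 1 := by
  have := add_sum_erase T (fun e => |inc (ends e) {v}|) he
  rw [abs_inc_eq h1] at this
  unfold dv; linarith

/-- a tree with one edge at `v` -/
lemma leaf {W : Finset V} {ends : E → V × V} {v : V} {T : Finset E} (hW : OnW W ends) (hv : v ∈ W)
    (hT : Cr W ends T) (hd : dv ends T v = 1) : CrI W v ends T := by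
  intro X hX hne hXW
  obtain ⟨e0, he0, hi0⟩ := dv_exists (show dv ends T v ≠ 0 by omega)
  obtain ⟨u, huv, hu⟩ := edge_of_inc hi0
  have hvX : v ∉ X := fun h => by have := hX h; simp at this
  have hinn : ∀ e ∈ T, e ≠ e0 → ∀ Y, inc (ends e) Y ≠ 0 → isIn (W \ {v}) (ends e) := by
    intro e he hne Y hY
    have h0 : inc (ends e) {v} = 0 := by
      by_contra h
      have := dv_two he he0 hne h hi0
      omega
    have h1 := hW e
    have h2 : (ends e).1 = v ↔ (ends e).2 = v := by
      by_contra h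
      exact (inc_ne (p := ends e) (B := {v})).2 (by simpa using h) h0
    have h3 : (ends e).1 ≠ v := by
      intro h
      have h4 := h2.1 h
      rw [inc_ne, h, h4] at hY
      exact hY Iff.rfl
    exact ⟨by simp [h1.1, h3], by
      have h5 : (ends e).2 ≠ v := fun h => h3 (h2.2 h)
      simp [h1.2, h5]⟩
  have hXsub : X ⊆ W := hX.trans sdiff_subset
  by_cases huX : u ∈ X
  · obtain ⟨e, he, hc⟩ := hT (insert v X) (insert_subset hv hXsub) (by simp) (by
      intro h
      apply hXW
      ext x
      by_cases hx : x = v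
      · subst hx; simp [hvX]
      · have : x ∈ insert v X ↔ x ∈ W := by rw [h]
        simpa [hx] using this)
    have hee : e ≠ e0 := by
      rintro rfl
      rw [cross_iff hu] at hc
      exact hc (by simp [huX])
    have hin := hinn e he hee _ hc
    refine ⟨e, he, hin, ?_⟩
    rw [inc_ne] at hc ⊢
    have h1 : (ends e).1 ≠ v := by have := hin.1; simp at this; exact this.2
    have h2 : (ends e).2 ≠ v := by have := hin.2; simp at this; exact this.2
    simpa [h1, h2] using hc
  · obtain ⟨e, he, hc⟩ := hT X hXsub hne (fun h => hvX (h ▸ hv))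
    have hee : e ≠ e0 := by
      rintro rfl
      rw [cross_iff hu] at hc
      exact hc (by simp [huX, hvX])
    exact ⟨e, he, hinn e he hee _ hc, hc⟩

/-- cut witnessing that an edge at `v` cannot be removed -/
lemma cut_wit [DecidableEq E] {W : Finset V} {ends : E → V × V} {v : V} {T : Finset E}
    (hW : OnW W ends) (hv : v ∈ W)
    (hT : Cr W ends T) {e : E} (he : e ∈ T) (hn : ¬ Cr W ends (T.erase e)) :
    ∃ X ⊆ W, v ∉ X ∧ inc (ends e) X ≠ 0 ∧ ∀ f ∈ T, inc (ends f) X ≠ 0 → f = e := by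
  unfold Cr at hn
  push Not at hn
  obtain ⟨X, hX, hne, hXW, hno⟩ := hn
  have hno' : ∀ f ∈ T, inc (ends f) X ≠ 0 → f = e := by
    intro f hf hc
    by_contra h
    exact hc (hno f (mem_erase.2 ⟨h, hf⟩))
  have hce : inc (ends e) X ≠ 0 := by
    obtain ⟨f, hf, hc⟩ := hT X hX hne hXW
    have := hno' f hf hc
    rwa [this] at hc
  by_cases hvX : v ∈ X
  · have hcompl : ∀ f, inc (ends f) (W \ X) ≠ 0 ↔ inc (ends f) X ≠ 0 := fun f => by
      rw [inc_compl (hW f).1 (hW f).2, neg_ne_zero]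
    exact ⟨W \ X, sdiff_subset, by simp [hvX], (hcompl e).2 hce,
      fun f hf hc => hno' f hf ((hcompl f).1 hc)⟩
  · exact ⟨X, hX, hvX, hce, hno'⟩

/-- lifting inside a tree keeps it connected -/
lemma lift_Cr [DecidableEq E] {W : Finset V} {ends : E → V × V} {v u w : V} {T : Finset E}
    (hW : OnW W ends) (hv : v ∈ W) (hw : w ∈ W)
    (hT : Cr W ends T) {e f : E} (he : e ∈ T) (hf : f ∉ T)
    (hu : ends e = (v, u) ∨ ends e = (u, v)) {X : Finset V} (hX : X ⊆ W) (hvX : v ∉ X)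
    (hce : inc (ends e) X ≠ 0) (hno : ∀ g ∈ T, inc (ends g) X ≠ 0 → g = e) (hwX : w ∉ X) :
    Cr W (Function.update (Function.update ends e (u, w)) f (v, v)) T := by
  have huX : u ∈ X := by
    rw [cross_iff hu] at hce
    by_contra h
    exact hce (by simp [hvX, h])
  -- it suffices to treat sides avoiding v
  have key : ∀ Y ⊆ W, v ∉ Y → (∀ g ∈ T, inc (ends g) Y ≠ 0 → g = e) → u ∈ Y → w ∈ Y → False := by
    intro Y hY hvY hYno huY hwY
    obtain ⟨g, hg, hc⟩ := hT (Y \ X) (sdiff_subset.trans hY) ⟨w, by simp [hwY, hwX]⟩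
      (fun h => by have : v ∈ Y \ X := by rw [h]; exact hv
                   exact hvY (mem_sdiff.1 this).1)
    have hge : g = e := by
      by_cases h1 : inc (ends g) Y ≠ 0
      · exact hYno g hg h1
      · apply hno g hg
        rw [inc_ne] at hc h1 ⊢
        simp only [mem_sdiff] at hc
        tauto
    rw [hge, cross_iff hu] at hc
    exact hc (by simp [hvY, huX])
  intro Y hY hne hYW
  obtain ⟨g, hg, hc⟩ := hT Y hY hne hYW
  have hgf : ∀ g ∈ T, g ≠ f := fun g hg h => hf (h ▸ hg)
  by_cases hall : ∀ g ∈ T, inc (ends g) Y ≠ 0 → g = e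
  · have hge := hall g hg hc
    subst hge
    refine ⟨g, hg, ?_⟩
    rw [Function.update_of_ne (hgf g hg), Function.update_self, inc_ne]
    intro huw
    dsimp only at huw
    rw [cross_iff hu] at hc
    by_cases hvY : v ∈ Y
    · have huY : u ∉ Y := fun h => hc (by simp [hvY, h])
      have hwY : w ∉ Y := fun h => huY (huw.2 h)
      refine key (W \ Y) sdiff_subset (by simp [hvY]) ?_ (by simp [hX huX, huY]) (by simp [hw, hwY])
      intro g' hg' hc'
      rw [inc_compl (hW g').1 (hW g').2, neg_ne_zero] at hc'
      exact hall g' hg' hc'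
    · have huY : u ∈ Y := by
        by_contra h; exact hc (by simp [hvY, h])
      exact key Y hY hvY hall huY (huw.1 huY)
  · push Not at hall
    obtain ⟨g', hg', hc', hge⟩ := hall
    refine ⟨g', hg', ?_⟩
    rwa [Function.update_of_ne (hgf g' hg'), Function.update_of_ne hge]

end Tree
end EqF

set_option linter.unusedSectionVars false
set_option linter.unusedVariables false

namespace EqF

section Tree2
variable {V E : Type*} [DecidableEq V] [Fintype E]

lemma dv_congr {ends ends' : E → V × V} {T : Finset E} {v : V} (h : ∀ e ∈ T, ends' e = ends e) :
    dv ends' T v = dv ends T v := sum_congr rfl fun e he => by rw [h e he]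

lemma Cr_congr {ends ends' : E → V × V} {T : Finset E} {W : Finset V}
    (h : ∀ e ∈ T, ends' e = ends e) (hT : Cr W ends T) : Cr W ends' T := by
  intro X h1 h2 h3
  obtain ⟨e, he, hc⟩ := hT X h1 h2 h3
  exact ⟨e, he, by rwa [h e he]⟩

lemma dv_nonneg (ends : E → V × V) (T : Finset E) (v : V) : 0 ≤ dv ends T v :=
  sum_nonneg fun _ _ => abs_nonneg _

lemma dv_sum_le {m : ℕ} [DecidableEq E] (ends : E → V × V) (T : Fin m → Finset E)
    (hT : ∀ i j, i ≠ j → Disjoint (T i) (T j)) (U : Finset (Fin m)) (v : V) :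
    ∑ i ∈ U, dv ends (T i) v ≤ dG ends {v} := by
  unfold dv dG
  rw [← sum_biUnion (fun i _ j _ h => hT i j h)]
  exact sum_le_sum_of_subset_of_nonneg (subset_univ _) fun _ _ _ => abs_nonneg _

lemma dv_sum_eq {m : ℕ} [DecidableEq E] (ends : E → V × V) (T : Fin m → Finset E)
    (hT : ∀ i j, i ≠ j → Disjoint (T i) (T j)) (U : Finset (Fin m)) (v : V)
    (h : ∀ f, inc (ends f) {v} ≠ 0 → ∃ i ∈ U, f ∈ T i) :
    dG ends {v} ≤ ∑ i ∈ U, dv ends (T i) v := by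
  unfold dv dG
  rw [← sum_biUnion (fun i _ j _ h => hT i j h)]
  apply le_of_eq
  symm
  refine sum_subset (subset_univ _) fun f _ hf => ?_
  by_contra hc
  obtain ⟨i, hi, hfi⟩ := h f (fun h => hc (by rw [h, abs_zero]))
  exact hf (mem_biUnion.2 ⟨i, hi, hfi⟩)

lemma tl {k : ℤ} (hk : 2 ≤ k) {m : ℕ} {W : Finset V} {ρ : V → ℤ} {v : V}
    (hv : v ∈ W) (hW2 : 2 ≤ W.card) (ih : IHt k W m E) (rho : 2 * k ∣ ∑ v ∈ W, ρ v) :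
    ∀ (N : ℕ) (U : Finset (Fin m)) (ends : E → V × V) (T : Fin m → Finset E),
    OnW W ends → (∀ v ∈ W, (2 : ℤ) ∣ ρ v - bd ends (fun _ => 1) {v}) →
    (∀ i j, i ≠ j → Disjoint (T i) (T j)) → (∀ i ∈ U, Cr W ends (T i)) →
    (∀ i ∉ U, CrI W v ends (T i)) →
    k ≤ dG ends {v} - 2 * ∑ i ∈ U, (dv ends (T i) v - 1) →
    ∑ i ∈ U, (dv ends (T i) v + 1) ≤ N → Sol k W ends ρ := by
  classical
  intro N
  induction N with
  | zero =>
    intro U ends T hW par hT hU hI hd hN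
    have hU0 : U = ∅ := by
      by_contra h
      obtain ⟨i, hi⟩ := nonempty_iff_ne_empty.2 h
      have := single_le_sum (f := fun i => dv ends (T i) v + 1) (s := U)
        (fun i _ => by have := dv_nonneg ends (T i) v; positivity) hi
      have h2 := dv_nonneg ends (T i) v
      simp only [Nat.cast_zero] at hN
      omega
    subst hU0
    exact tl_empty hk hv hW2 ih hW rho par T hT (fun i => hI i (by simp)) (by simpa using hd)
  | succ N IH =>
    intro U ends T hW par hT hU hI hd hN
    rcases eq_empty_or_nonempty U with hU0 | ⟨i0, hi0⟩
    · subst hU0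
      exact tl_empty hk hv hW2 ih hW rho par T hT (fun i => hI i (by simp)) (by simpa using hd)
    push_cast at hN
    by_cases hleaf : ∃ i ∈ U, dv ends (T i) v = 1
    · obtain ⟨i, hi, h1⟩ := hleaf
      have e1 := add_sum_erase U (fun i => dv ends (T i) v - 1) hi
      have e2 := add_sum_erase U (fun i => dv ends (T i) v + 1) hi
      refine IH (U.erase i) ends T hW par hT (fun j hj => hU j (mem_of_mem_erase hj)) ?_ ?_ ?_
      · intro j hj
        by_cases hji : j = i
        · rw [hji]; exact leaf hW hv (hU i hi) h1
        · exact hI j fun h => hj (mem_erase.2 ⟨hji, h⟩)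
      · linarith
      · linarith
    by_cases hrem : ∃ i ∈ U, ∃ e ∈ T i, inc (ends e) {v} ≠ 0 ∧ Cr W ends ((T i).erase e)
    · obtain ⟨i, hi, e, he, hie, hc⟩ := hrem
      have e1 := add_sum_erase U (fun i => dv ends (T i) v - 1) hi
      have e2 := add_sum_erase U (fun i => dv ends (T i) v + 1) hi
      have e3 := add_sum_erase U
        (fun j => dv ends (Function.update T i ((T i).erase e) j) v - 1) hi
      have e4 := add_sum_erase U
        (fun j => dv ends (Function.update T i ((T i).erase e) j) v + 1) hi
      have e5 : ∀ j ∈ U.erase i, dv ends (Function.update T i ((T i).erase e) j) v =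
          dv ends (T j) v := fun j hj => by rw [Function.update_of_ne (ne_of_mem_erase hj)]
      have e6 := sum_congr rfl fun j hj => congrArg (· - 1) (e5 j hj)
      have e7 := sum_congr rfl fun j hj => congrArg (· + 1) (e5 j hj)
      have e8 := dv_erase he hie
      simp only [Function.update_self] at e1 e2 e3 e4 e6 e7
      have hsub : ∀ j, Function.update T i ((T i).erase e) j ⊆ T j := by
        intro j
        by_cases hj : j = i
        · subst hj; rw [Function.update_self]; exact erase_subset _ _
        · rw [Function.update_of_ne hj]
      refine IH U ends (Function.update T i ((T i).erase e)) hW par ?_ ?_ ?_ ?_ ?_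
      · intro a b hab
        exact (hT a b hab).mono (hsub a) (hsub b)
      · intro j hj
        by_cases hji : j = i
        · subst hji; rw [Function.update_self]; exact hc
        · rw [Function.update_of_ne hji]; exact hU j hj
      · intro j hj
        have hji : j ≠ i := fun h => hj (h ▸ hi)
        rw [Function.update_of_ne hji]; exact hI j hj
      · linarith
      · linarith
    push Not at hleaf hrem
    have hVW : ({v} : Finset V) ≠ W := by
      intro h; rw [← h] at hW2; simp at hW2
    have hdv : ∀ i ∈ U, 2 ≤ dv ends (T i) v := by
      intro i hi
      obtain ⟨e, he, hc⟩ := hU i hi {v} (by simpa using hv) (by simp) hVW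
      have h1 := dv_one he hc
      have h2 := hleaf i hi
      omega
    obtain ⟨f, hf, hfU⟩ : ∃ f, inc (ends f) {v} ≠ 0 ∧ ∀ i ∈ U, f ∉ T i := by
      by_contra! h
      have h1 := dv_sum_eq ends T hT U v h
      have h2 : ∑ i ∈ U, dv ends (T i) v ≤ ∑ i ∈ U, 2 * (dv ends (T i) v - 1) :=
        sum_le_sum fun i hi => by have := hdv i hi; omega
      rw [← mul_sum] at h2
      omega
    obtain ⟨w, hwv, hfw⟩ := edge_of_inc hf
    have hwW : w ∈ W := by
      have := hW f
      rcases hfw with h | h <;> rw [h] at this <;> tauto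
    obtain ⟨e1, he1, hi1⟩ := dv_exists (show dv ends (T i0) v ≠ 0 by have := hdv i0 hi0; omega)
    obtain ⟨e2, he2', hi2⟩ := dv_exists (show dv ends ((T i0).erase e1) v ≠ 0 by
      rw [dv_erase he1 hi1]; have := hdv i0 hi0; omega)
    obtain ⟨hne, he2⟩ := mem_erase.1 he2'
    obtain ⟨X1, hX1, hv1, hc1, hn1⟩ := cut_wit hW hv (hU i0 hi0) he1 (hrem i0 hi0 e1 he1 hi1)
    obtain ⟨X2, hX2, hv2, hc2, hn2⟩ := cut_wit hW hv (hU i0 hi0) he2 (hrem i0 hi0 e2 he2 hi2)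
    have huncr : ¬ (w ∈ X1 ∧ w ∈ X2) := by
      rintro ⟨hw1, hw2⟩
      obtain ⟨g, hg, hc⟩ := hU i0 hi0 (X1 ∩ X2) (inter_subset_left.trans hX1)
        ⟨w, mem_inter.2 ⟨hw1, hw2⟩⟩ (fun h => hv1 (mem_inter.1 (h ▸ hv)).1)
      rw [inc_ne] at hc
      simp only [mem_inter] at hc
      have h3 : inc (ends g) X1 ≠ 0 ∨ inc (ends g) X2 ≠ 0 := by
        rw [inc_ne, inc_ne]; tauto
      rcases h3 with h3 | h3
      · have hg1 := hn1 g hg h3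
        subst hg1
        have h4 : inc (ends g) X2 ≠ 0 := by
          obtain ⟨u, huv, hu⟩ := edge_of_inc hi1
          rw [inc_ne]
          rcases hu with hu | hu <;> rw [hu] at hc ⊢ <;> simp only [hv1, hv2] at hc ⊢ <;> tauto
        exact hne (hn2 g hg h4).symm
      · have hg1 := hn2 g hg h3
        subst hg1
        have h4 : inc (ends g) X1 ≠ 0 := by
          obtain ⟨u, huv, hu⟩ := edge_of_inc hi2
          rw [inc_ne]
          rcases hu with hu | hu <;> rw [hu] at hc ⊢ <;> simp only [hv1, hv2] at hc ⊢ <;> tauto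
        exact hne (hn1 g hg h4)
    obtain ⟨e, he, hie, X, hX, hvX, hce, hno, hwX⟩ : ∃ e ∈ T i0, inc (ends e) {v} ≠ 0 ∧
        ∃ X ⊆ W, v ∉ X ∧ inc (ends e) X ≠ 0 ∧ (∀ f ∈ T i0, inc (ends f) X ≠ 0 → f = e) ∧
          w ∉ X := by
      by_cases hw1 : w ∈ X1
      · exact ⟨e2, he2, hi2, X2, hX2, hv2, hc2, hn2, fun h => huncr ⟨hw1, h⟩⟩
      · exact ⟨e1, he1, hi1, X1, hX1, hv1, hc1, hn1, hw1⟩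
    obtain ⟨u, huv, hu⟩ := edge_of_inc hie
    have hef : e ≠ f := fun h => hfU i0 hi0 (h ▸ he)
    have hLC := lift_Cr hW hv hwW (hU i0 hi0) he (hfU i0 hi0) hu hX hvX hce hno hwX
    refine lift_sol hef hu hfw ?_
    have hsame : ∀ j ∈ U, j ≠ i0 → ∀ g ∈ T j,
        Function.update (Function.update ends e (u, w)) f (v, v) g = ends g := by
      intro j hj hji g hg
      have h1 : g ≠ f := fun h => hfU j hj (h ▸ hg)
      have h2 : g ≠ e := fun h => disjoint_left.1 (hT j i0 hji) hg (h ▸ he)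
      rw [Function.update_of_ne h1, Function.update_of_ne h2]
    have hdG := lift_dG hef hu hfw {v}
    have hdG2 : dG (Function.update (Function.update ends e (u, w)) f (v, v)) {v} =
        dG ends {v} - 2 := by
      rw [hdG]
      simp [ind, huv, hwv]; ring
    have hdvi : dv (Function.update (Function.update ends e (u, w)) f (v, v)) (T i0) v =
        dv ends (T i0) v - 1 := by
      rw [← dv_erase he hie]
      have h1 := add_sum_erase (T i0) (fun g => |inc (Function.update (Function.update ends e (u, w)) f (v, v) g) {v}|) he
      unfold dv
      rw [← h1]
      have h2 : inc (Function.update (Function.update ends e (u, w)) f (v, v) e) {v} = 0 := by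
        rw [Function.update_of_ne hef, Function.update_self]
        simp [inc, ind, huv, hwv]
      simp only [h2, abs_zero, zero_add]
      refine sum_congr rfl fun g hg => ?_
      have h3 : g ≠ f := fun h => hfU i0 hi0 (h ▸ mem_of_mem_erase hg)
      rw [Function.update_of_ne h3, Function.update_of_ne (ne_of_mem_erase hg)]
    have a1 := add_sum_erase U (fun i => dv ends (T i) v - 1) hi0
    have a2 := add_sum_erase U (fun i => dv ends (T i) v + 1) hi0
    have a3 := add_sum_erase U (fun i => dv (Function.update (Function.update ends e (u, w)) f (v, v)) (T i) v - 1) hi0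
    have a4 := add_sum_erase U (fun i => dv (Function.update (Function.update ends e (u, w)) f (v, v)) (T i) v + 1) hi0
    have a5 : ∀ j ∈ U.erase i0, dv (Function.update (Function.update ends e (u, w)) f (v, v)) (T j) v
        = dv ends (T j) v := fun j hj =>
      dv_congr (hsame j (mem_of_mem_erase hj) (ne_of_mem_erase hj))
    have a6 := sum_congr rfl fun j hj => congrArg (· - 1) (a5 j hj)
    have a7 := sum_congr rfl fun j hj => congrArg (· + 1) (a5 j hj)
    refine IH U _ T (lift_onW hW hu hfw) (lift_par hef hu hfw par) hT ?_ ?_ ?_ ?_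
    · intro j hj
      by_cases hji : j = i0
      · rw [hji]; exact hLC
      · exact Cr_congr (hsame j hj hji) (hU j hj)
    · intro j hj Y h1 h2 h3
      obtain ⟨g, hg, hgi, hgc⟩ := hI j hj Y h1 h2 h3
      have hg0 : inc (ends g) {v} = 0 := by
        have h4 := (mem_sdiff.1 hgi.1).2
        have h5 := (mem_sdiff.1 hgi.2).2
        unfold inc; rw [ind_not h4, ind_not h5]; rfl
      have hgf : g ≠ f := fun h => hf (h ▸ hg0)
      have hge : g ≠ e := fun h => hie (h ▸ hg0)
      refine ⟨g, hg, ?_⟩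
      rw [Function.update_of_ne hgf, Function.update_of_ne hge]
      exact ⟨hgi, hgc⟩
    · linarith
    · linarith

theorem tree_sol {k : ℤ} (hk : 2 ≤ k) {m : ℕ} (hm : (m : ℤ) = 2 * k - 2) :
    ∀ (n : ℕ) (W : Finset V) (ends : E → V × V) (ρ : V → ℤ) (T : Fin m → Finset E), W.card = n →
    OnW W ends → 2 * k ∣ ∑ v ∈ W, ρ v →
    (∀ v ∈ W, (2 : ℤ) ∣ ρ v - bd ends (fun _ => 1) {v}) →
    (∀ i j, i ≠ j → Disjoint (T i) (T j)) → (∀ i, Cr W ends (T i)) → Sol k W ends ρ := by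
  classical
  intro n
  induction n using Nat.strong_induction_on with
  | _ n IH =>
  intro W ends ρ T hn hW rho par hT hC
  have ih : IHt k W m E := by
    intro W' ends ρ T hlt
    exact IH W'.card (hn ▸ hlt) W' ends ρ T rfl
  by_cases hbad : ∃ A, A ⊆ W ∧ A.Nonempty ∧ A ≠ W ∧
      dG ends A < 2 * k - 2 + nrm k (∑ v ∈ A, ρ v)
  swap
  · refine nobad hk hW rho par fun A h1 h2 h3 => ?_
    by_contra h
    exact hbad ⟨A, h1, h2, h3, not_le.1 h⟩
  obtain ⟨A, ⟨hA, hAne, hAW, hAd⟩, hmin⟩ := exists_min_image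
    (W.powerset.filter fun A => A.Nonempty ∧ A ≠ W ∧ dG ends A < 2 * k - 2 + nrm k (∑ v ∈ A, ρ v))
    card (by
      obtain ⟨A, h1, h2⟩ := hbad
      exact ⟨A, by simp only [mem_filter, mem_powerset]; exact ⟨h1, h2⟩⟩) |>.imp fun A h => by
        simpa only [mem_filter, mem_powerset] using h
  have hAcut : ∀ B ⊆ A, B.Nonempty → B ≠ A →
      2 * k - 2 + nrm k (∑ v ∈ B, ρ v) ≤ dG ends B := by
    intro B h1 h2 h3
    by_contra h
    have h4 := card_lt_card (h1.ssubset_of_ne h3)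
    have h5 := hmin B ⟨h1.trans hA, h2, fun h => h3 (subset_antisymm h1 (h ▸ hA)), not_le.1 h⟩
    omega
  by_cases hA2 : 2 ≤ A.card
  · obtain ⟨a, ha⟩ := hAne
    have h1 : Sol k (insert a (W \ A)) (cE A a ends) (cF A a ρ) := by
      refine ih _ _ _ T (card_cW ha hA hA2) (onW_cE hW) (contr_rho ha hA rho)
        (contr_par ha hA par) hT fun i B h1 h2 h3 => ?_
      obtain ⟨e, he, hc⟩ := hC i (pre A a B) (pre_sub hA ha h1) (pre_nonempty h2)
        (pre_ne hA ha h1 h3)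
      exact ⟨e, he, by rwa [inc_cE ha h1]⟩
    obtain ⟨s, hs, h2, h3⟩ := contr_sol ha h1
    refine split_sol (a := a) hs hA h2 ?_
    exact core hk _ _ _ A _ _ _ _ _ rfl rfl rfl
      (inner_good (σ := ρ) (c := fun _ => 0) (ex := none) ha hA hs par (by simp) (by simp)
        (by simp) (fun B h1 h2 h3 _ => by simpa using hAcut B h1 h2 h3) (by simpa using hAd.le) h3)
  · have hA1 : A.card = 1 := by have := hAne.card_pos; omega
    obtain ⟨v, rfl⟩ := card_eq_one.1 hA1
    have hv : v ∈ W := hA (mem_singleton_self v)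
    have hW2 : 2 ≤ W.card := by
      have := card_lt_card (hA.ssubset_of_ne hAW)
      omega
    have hp := par_sum par hA
    have hp2 := nrm_par (by omega : 0 < k) (∑ u ∈ {v}, ρ u)
    have hp3 := nrm_le (by omega : 0 < k) (∑ u ∈ {v}, ρ u)
    have hd := dv_sum_le ends T hT univ v
    have hN : (0:ℤ) ≤ ∑ i ∈ univ, (dv ends (T i) v + 1) :=
      sum_nonneg fun i _ => by have := dv_nonneg ends (T i) v; omega
    refine tl hk hv hW2 ih rho (∑ i ∈ univ, (dv ends (T i) v + 1)).toNat univ ends T hW par hT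
      (fun i _ => hC i) (fun i hi => (hi (mem_univ i)).elim) ?_ (by rw [Int.toNat_of_nonneg hN])
    rw [sum_sub_distrib]
    simp only [sum_const, card_univ, Fintype.card_fin, nsmul_eq_mul, mul_one]
    omega

end Tree2
end EqF

set_option linter.unusedSectionVars false
set_option linter.unusedVariables false

namespace EqF

section Konig

/-- edge colouring of regular bipartite multigraphs -/
lemma konig_reg {E X : Type*} [Fintype X] [DecidableEq X] [DecidableEq E] (L R : E → X) :
    ∀ (k : ℕ) (S : Finset E), (∀ x, (S.filter fun e => L e = x).card = k) →
      (∀ x, (S.filter fun e => R e = x).card = k) →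
      ∃ c : E → ℕ, (∀ e ∈ S, c e < k) ∧
        (∀ e ∈ S, ∀ f ∈ S, L e = L f → c e = c f → e = f) ∧
        (∀ e ∈ S, ∀ f ∈ S, R e = R f → c e = c f → e = f) := by
  intro k
  induction k with
  | zero =>
    intro S hL hR
    have : ∀ e, e ∉ S := by
      intro e he
      have := card_eq_zero.1 (hL (L e))
      have h2 : e ∈ S.filter fun f => L f = L e := by simp [he]
      rw [this] at h2; simp at h2
    exact ⟨fun _ => 0, fun e he => (this e he).elim, fun e he => (this e he).elim,
      fun e he => (this e he).elim⟩
  | succ k IH =>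
    intro S hL hR
    have hall := (Finset.all_card_le_biUnion_card_iff_exists_injective
      (fun x => (S.filter fun e => L e = x).image R)).1 (by
        intro A
        set B := A.biUnion fun x => (S.filter fun e => L e = x).image R with hB
        have h1 : (S.filter fun e => L e ∈ A).card = A.card * (k + 1) := by
          rw [card_eq_sum_card_fiberwise (s := S.filter fun e => L e ∈ A) (f := L) (t := A)
            (fun e he => mem_coe.2 (mem_filter.1 (mem_coe.1 he)).2)]
          rw [sum_const_nat (m := k + 1)]
          intro x hx
          rw [← hL x, filter_filter]
          congr 1
          ext e; simp only [mem_filter]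
          constructor
          · tauto
          · rintro ⟨h1, h2⟩; exact ⟨h1, h2 ▸ hx, h2⟩
        have h2 : (S.filter fun e => R e ∈ B).card = B.card * (k + 1) := by
          rw [card_eq_sum_card_fiberwise (s := S.filter fun e => R e ∈ B) (f := R) (t := B)
            (fun e he => mem_coe.2 (mem_filter.1 (mem_coe.1 he)).2)]
          rw [sum_const_nat (m := k + 1)]
          intro x hx
          rw [← hR x, filter_filter]
          congr 1
          ext e; simp only [mem_filter]
          constructor
          · tauto
          · rintro ⟨h1, h2⟩; exact ⟨h1, h2 ▸ hx, h2⟩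
        have h3 : (S.filter fun e => L e ∈ A) ⊆ S.filter fun e => R e ∈ B := by
          intro e he
          rw [mem_filter] at he ⊢
          refine ⟨he.1, ?_⟩
          rw [hB, mem_biUnion]
          exact ⟨L e, he.2, mem_image.2 ⟨e, by simp [he.1], rfl⟩⟩
        have h4 := card_le_card h3
        rw [h1, h2] at h4
        exact Nat.le_of_mul_le_mul_right h4 (by omega))
    obtain ⟨f, hf, hft⟩ := hall
    have hch : ∀ x, ∃ e ∈ S, L e = x ∧ R e = f x := by
      intro x
      obtain ⟨e, he, h⟩ := mem_image.1 (hft x)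
      rw [mem_filter] at he
      exact ⟨e, he.1, he.2, h⟩
    choose M hMS hML hMR using hch
    have hfs : Function.Surjective f := Finite.surjective_of_injective hf
    have hmem : ∀ e, e ∈ univ.image M ↔ ∃ x, M x = e := by simp
    obtain ⟨c, hc1, hc2, hc3⟩ := IH (S \ univ.image M) (by
      intro x
      have h1 : (S \ univ.image M).filter (fun e => L e = x) =
          (S.filter fun e => L e = x).erase (M x) := by
        ext e
        simp only [mem_filter, mem_sdiff, mem_erase, hmem]
        constructor
        · rintro ⟨⟨h1, h2⟩, h3⟩
          exact ⟨fun h => h2 ⟨x, h.symm⟩, h1, h3⟩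
        · rintro ⟨h1, h2, h3⟩
          refine ⟨⟨h2, ?_⟩, h3⟩
          rintro ⟨y, hy⟩
          have : y = x := by rw [← hML y, hy, h3]
          exact h1 (by rw [← this, hy])
      rw [h1, card_erase_of_mem (by simp [hMS, hML]), hL]; rfl) (by
      intro x
      obtain ⟨y, rfl⟩ := hfs x
      have h1 : (S \ univ.image M).filter (fun e => R e = f y) =
          (S.filter fun e => R e = f y).erase (M y) := by
        ext e
        simp only [mem_filter, mem_sdiff, mem_erase, hmem]
        constructor
        · rintro ⟨⟨h1, h2⟩, h3⟩
          exact ⟨fun h => h2 ⟨y, h.symm⟩, h1, h3⟩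
        · rintro ⟨h1, h2, h3⟩
          refine ⟨⟨h2, ?_⟩, h3⟩
          rintro ⟨y', hy⟩
          have : y' = y := hf (by rw [← hMR y', hy, h3])
          exact h1 (by rw [← this, hy])
      rw [h1, card_erase_of_mem (by simp [hMS, hMR]), hR]; rfl)
    have main : ∀ K : E → X, (∀ x y, K (M x) = K (M y) → x = y) →
        (∀ e ∈ S \ univ.image M, ∀ g ∈ S \ univ.image M, K e = K g → c e = c g → e = g) →
        ∀ e ∈ S, ∀ g ∈ S, K e = K g →
          (if e ∈ univ.image M then k else c e) = (if g ∈ univ.image M then k else c g) → e = g := by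
      intro K hK hc e he g hg heg h
      by_cases h1 : e ∈ univ.image M <;> by_cases h2 : g ∈ univ.image M
      · obtain ⟨x, hx⟩ := (hmem e).1 h1
        obtain ⟨y, hy⟩ := (hmem g).1 h2
        rw [← hx, ← hy] at heg ⊢
        rw [hK x y heg]
      · rw [if_pos h1, if_neg h2] at h
        have := hc1 g (mem_sdiff.2 ⟨hg, h2⟩)
        omega
      · rw [if_neg h1, if_pos h2] at h
        have := hc1 e (mem_sdiff.2 ⟨he, h1⟩)
        omega
      · rw [if_neg h1, if_neg h2] at h
        exact hc e (mem_sdiff.2 ⟨he, h1⟩) g (mem_sdiff.2 ⟨hg, h2⟩) heg h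
    refine ⟨fun e => if e ∈ univ.image M then k else c e, ?_, ?_, ?_⟩
    · intro e he
      dsimp only
      split_ifs with h
      · omega
      · have := hc1 e (mem_sdiff.2 ⟨he, h⟩); omega
    · exact main L (fun x y h => by rwa [hML, hML] at h) hc2
    · exact main R (fun x y h => by rw [hMR, hMR] at h; exact hf h) hc3

/-- edge colouring of bipartite multigraphs -/
lemma konig {E X : Type*} [Fintype E] [Fintype X] [DecidableEq X] (L R : E → X) (k : ℕ)
    (hL : ∀ x, (univ.filter fun e => L e = x).card ≤ k)
    (hR : ∀ x, (univ.filter fun e => R e = x).card ≤ k) :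
    ∃ c : E → Fin k, (∀ e f, L e = L f → c e = c f → e = f) ∧
      (∀ e f, R e = R f → c e = c f → e = f) := by
  classical
  let dL : X → ℕ := fun x => (univ.filter fun e => L e = x).card
  let dR : X → ℕ := fun x => (univ.filter fun e => R e = x).card
  have sum_d : ∀ K : E → X, ∑ x, (univ.filter fun e => K e = x).card = Fintype.card E := by
    intro K
    rw [← card_univ, card_eq_sum_card_fiberwise (f := K) (t := univ) (fun e _ => mem_coe.2 (mem_univ _))]
  have hcard : Fintype.card (Σ x, Fin (k - dL x)) = Fintype.card (Σ x, Fin (k - dR x)) := by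
    simp only [Fintype.card_sigma, Fintype.card_fin]
    have h1 : ∑ x, (k - dL x) + ∑ x, dL x = ∑ x, (k - dR x) + ∑ x, dR x := by
      rw [← sum_add_distrib, ← sum_add_distrib]
      refine sum_congr rfl fun x _ => ?_
      have := hL x; have := hR x
      show k - dL x + dL x = k - dR x + dR x
      simp only [dL, dR]; omega
    have h2 : ∑ x, dL x = Fintype.card E := sum_d L
    have h3 : ∑ x, dR x = Fintype.card E := sum_d R
    omega
  let φ := Fintype.equivOfCardEq hcard
  let L' : E ⊕ (Σ x, Fin (k - dL x)) → X := Sum.elim L (fun p => p.1)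
  let R' : E ⊕ (Σ x, Fin (k - dL x)) → X := Sum.elim R (fun p => (φ p).1)
  have cnt : ∀ (d : X → ℕ) (x : X),
      (univ.filter fun p : Σ x, Fin (d x) => p.1 = x).card = d x := by
    intro d x
    have : (univ.filter fun p : Σ x, Fin (d x) => p.1 = x) =
        (univ : Finset (Fin (d x))).map ⟨fun i => (⟨x, i⟩ : Σ x, Fin (d x)), fun a b h => by simpa using h⟩ := by
      ext ⟨y, i⟩
      simp only [mem_filter, mem_univ, true_and, mem_map]
      constructor
      · rintro rfl; exact ⟨i, rfl⟩
      · rintro ⟨j, hj⟩; exact (congrArg Sigma.fst hj).symm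
    rw [this, card_map, card_univ, Fintype.card_fin]
  have spl : ∀ K : E ⊕ (Σ x, Fin (k - dL x)) → X, ∀ x,
      (univ.filter fun e => K e = x).card = (univ.filter fun e => K (Sum.inl e) = x).card +
        (univ.filter fun e => K (Sum.inr e) = x).card := by
    intro K x
    simp only [card_filter, Fintype.sum_sum_type]
  obtain ⟨c, h1, h2, h3⟩ := konig_reg L' R' k univ (by
    intro x
    rw [spl]
    show dL x + (univ.filter fun p : Σ x, Fin (k - dL x) => p.1 = x).card = k
    rw [cnt (fun x => k - dL x) x]
    have := hL x
    show dL x + (k - dL x) = k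
    simp only [dL]; omega) (by
    intro x
    rw [spl]
    show dR x + (univ.filter fun p : Σ x, Fin (k - dL x) => (φ p).1 = x).card = k
    have : (univ.filter fun p : Σ x, Fin (k - dL x) => (φ p).1 = x).card =
        (univ.filter fun p : Σ x, Fin (k - dR x) => p.1 = x).card := by
      refine card_bij (fun p _ => φ p) ?_ ?_ ?_
      · intro p hp; simpa using hp
      · intro p _ q _ h; exact φ.injective h
      · intro q hq; exact ⟨φ.symm q, by simpa using hq, by simp⟩
    rw [this, cnt (fun x => k - dR x) x]
    have := hR x
    show dR x + (k - dR x) = k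
    simp only [dR]; omega)
  refine ⟨fun e => ⟨c (Sum.inl e), h1 _ (mem_univ _)⟩, ?_, ?_⟩
  · intro e f hef hc
    exact Sum.inl_injective (h2 _ (mem_univ _) _ (mem_univ _) hef (by simpa using hc))
  · intro e f hef hc
    exact Sum.inl_injective (h3 _ (mem_univ _) _ (mem_univ _) hef (by simpa using hc))

lemma enum_exists {E : Type*} (F : Finset E) :
    ∃ g : E → ℕ, (∀ e ∈ F, g e < F.card) ∧ (∀ e ∈ F, ∀ f ∈ F, g e = g f → e = f) ∧
      ∀ j < F.card, ∃ e ∈ F, g e = j := by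
  classical
  refine ⟨fun e => if h : e ∈ F then (F.equivFin ⟨e, h⟩ : ℕ) else 0, ?_, ?_, ?_⟩
  · intro e he; simp only [he, dif_pos]; exact Fin.is_lt _
  · intro e he f hf h
    simp only [he, hf, dif_pos] at h
    have := F.equivFin.injective (Fin.ext h)
    simpa using this
  · intro j hj
    refine ⟨F.equivFin.symm ⟨j, hj⟩, (F.equivFin.symm ⟨j, hj⟩).2, ?_⟩
    simp

/-- chunked enumeration of the fibres -/
lemma chunk_exists {E V : Type*} [Fintype E] [DecidableEq V] (t : E → V) :
    ∃ g : E → ℕ, (∀ e, g e < (univ.filter fun f => t f = t e).card) ∧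
      (∀ e f, t e = t f → g e = g f → e = f) ∧
      ∀ v, ∀ j < (univ.filter fun f => t f = v).card, ∃ e, t e = v ∧ g e = j := by
  choose g h1 h2 h3 using fun v => enum_exists (univ.filter fun f => t f = v)
  refine ⟨fun e => g (t e) e, fun e => h1 _ e (by simp), ?_, ?_⟩
  · intro e f hef h
    dsimp only at h
    rw [hef] at h
    exact h2 (t f) e (by simp [hef]) f (by simp) h
  · intro v j hj
    obtain ⟨e, he, h⟩ := h3 v j hj
    simp only [mem_filter, mem_univ, true_and] at he
    exact ⟨e, he, by dsimp only; rw [he]; exact h⟩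

lemma chunk_card {E V : Type*} [Fintype E] [DecidableEq V] (t : E → V) (k : ℕ) (hk : 0 < k)
    (g : E → ℕ) (h2 : ∀ e f, t e = t f → g e = g f → e = f) (v : V) (j : ℕ) :
    (univ.filter fun e => t e = v ∧ g e / k = j).card ≤ k := by
  have : (univ.filter fun e => t e = v ∧ g e / k = j).card ≤ (Ico (j * k) (j * k + k)).card := by
    refine card_le_card_of_injOn g ?_ ?_
    · intro e he
      simp only [coe_filter, mem_univ, true_and, Set.mem_ofPred_eq] at he
      have h3 := Nat.div_add_mod (g e) k
      have h4 := Nat.mod_lt (g e) hk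
      rw [he.2, mul_comm] at h3
      rw [mem_coe, mem_Ico]; omega
    · intro e he f hf h
      simp only [coe_filter, mem_univ, true_and, Set.mem_ofPred_eq] at he hf
      exact h2 e f (he.1.trans hf.1.symm) h
  simpa using this

lemma chunk_count {E V : Type*} [Fintype E] [DecidableEq V] (t : E → V) (k : ℕ) (hk : 0 < k)
    (g : E → ℕ) (h1 : ∀ e, g e < (univ.filter fun f => t f = t e).card)
    (h2 : ∀ e f, t e = t f → g e = g f → e = f)
    (h3 : ∀ v, ∀ j < (univ.filter fun f => t f = v).card, ∃ e, t e = v ∧ g e = j)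
    (c : E → Fin k) (hc : ∀ e f, t e = t f → g e / k = g f / k → c e = c f → e = f)
    (v : V) (i : Fin k) :
    (univ.filter fun e => t e = v).card / k ≤ (univ.filter fun e => t e = v ∧ c e = i).card ∧
    (univ.filter fun e => t e = v ∧ c e = i).card ≤
      ((univ.filter fun e => t e = v).card + (k - 1)) / k := by
  classical
  set n := (univ.filter fun e => t e = v).card with hn
  constructor
  · have hsub : range (n / k) ⊆ (univ.filter fun e => t e = v ∧ c e = i).image fun e => g e / k := by
      intro j hj
      rw [mem_range] at hj
      have hjn : j * k + k ≤ n := by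
        have h4 := Nat.div_mul_le_self n k
        have h5 : (j + 1) * k ≤ n / k * k := Nat.mul_le_mul_right k hj
        rw [add_mul, one_mul] at h5
        omega
      have hex : ∀ r : Fin k, ∃ e, t e = v ∧ g e = j * k + r := fun r =>
        h3 v _ (by have := r.2; omega)
      choose e he1 he2 using hex
      have hdiv : ∀ r, g (e r) / k = j := by
        intro r
        rw [he2, mul_comm, Nat.mul_add_div hk, Nat.div_eq_of_lt r.2, add_zero]
      have hinj : Function.Injective fun r => c (e r) := by
        intro r r' hr
        have h6 := hc (e r) (e r') ((he1 r).trans (he1 r').symm) ((hdiv r).trans (hdiv r').symm) hr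
        have h7 := he2 r
        rw [h6, he2 r'] at h7
        exact Fin.ext (by omega)
      obtain ⟨r, hr⟩ := Finite.surjective_of_injective hinj i
      exact mem_image.2 ⟨e r, by simp [he1 r]; exact hr, hdiv r⟩
    have := (card_le_card hsub).trans card_image_le
    simpa using this
  · have : (univ.filter fun e => t e = v ∧ c e = i).card ≤ (range ((n + (k - 1)) / k)).card := by
      refine card_le_card_of_injOn (fun e => g e / k) ?_ ?_
      · intro e he
        simp only [coe_filter, mem_univ, true_and, Set.mem_ofPred_eq] at he
        have h4 := h1 e
        rw [he.1, ← hn] at h4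
        rw [mem_coe, mem_range]
        rw [Nat.lt_iff_add_one_le, ← Nat.add_div_right _ hk]
        exact Nat.div_le_div_right (by omega)
      · intro e he f hf h
        simp only [coe_filter, mem_univ, true_and, Set.mem_ofPred_eq] at he hf
        exact hc e f (he.1.trans hf.1.symm) h (he.2.trans hf.2.symm)
    simpa using this

/-- equitable colouring of bipartite multigraphs -/
lemma equit {E V : Type*} [Fintype E] [Fintype V] [DecidableEq V] (t h : E → V) (k : ℕ)
    (hk : 0 < k) :
    ∃ c : E → Fin k, ∀ v i,
      ((univ.filter fun e => t e = v).card / k ≤ (univ.filter fun e => t e = v ∧ c e = i).card ∧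
      (univ.filter fun e => t e = v ∧ c e = i).card ≤
        ((univ.filter fun e => t e = v).card + (k - 1)) / k) ∧
      ((univ.filter fun e => h e = v).card / k ≤ (univ.filter fun e => h e = v ∧ c e = i).card ∧
      (univ.filter fun e => h e = v ∧ c e = i).card ≤
        ((univ.filter fun e => h e = v).card + (k - 1)) / k) := by
  obtain ⟨g, g1, g2, g3⟩ := chunk_exists t
  obtain ⟨g', g1', g2', g3'⟩ := chunk_exists h
  have bnd : ∀ (t : E → V) (g : E → ℕ), (∀ e, g e < (univ.filter fun f => t f = t e).card) →
      ∀ e, g e / k < Fintype.card E := fun t g hg e =>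
    (Nat.div_le_self _ _).trans_lt ((hg e).trans_le (by rw [← card_univ]; exact card_le_card (filter_subset _ _)))
  obtain ⟨c, hc1, hc2⟩ := konig (X := V × Fin (Fintype.card E))
    (fun e => (t e, ⟨g e / k, bnd t g g1 e⟩)) (fun e => (h e, ⟨g' e / k, bnd h g' g1' e⟩)) k
    (by
      rintro ⟨v, j⟩
      simp only [Prod.mk.injEq, Fin.ext_iff]
      exact chunk_card t k hk g g2 v j)
    (by
      rintro ⟨v, j⟩
      simp only [Prod.mk.injEq, Fin.ext_iff]
      exact chunk_card h k hk g' g2' v j)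
  simp only [Prod.mk.injEq, Fin.ext_iff] at hc1 hc2
  refine ⟨c, fun v i => ⟨?_, ?_⟩⟩
  · exact chunk_count t k hk g g1 g2 g3 c (fun e f a b d => hc1 e f ⟨a, b⟩ (Fin.ext_iff.1 d)) v i
  · exact chunk_count h k hk g' g1' g2' g3' c (fun e f a b d => hc2 e f ⟨a, b⟩ (Fin.ext_iff.1 d)) v i

end Konig
end EqF

set_option linter.unusedSectionVars false
set_option linter.unusedVariables false

namespace EqF

section Final

lemma dev_lt {n x k : ℕ} (hk : 0 < k) (h1 : n / k ≤ x) (h2 : x ≤ (n + (k - 1)) / k) :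
    |(x : ℝ) - (n : ℝ) / (k : ℝ)| < 1 := by
  have h3 : n < (x + 1) * k := (Nat.div_lt_iff_lt_mul hk).1 (by omega)
  have h4 : x * k ≤ n + (k - 1) := (Nat.le_div_iff_mul_le hk).1 h2
  have h5 : x * k < n + k := by omega
  have hk' : (0 : ℝ) < k := by exact_mod_cast hk
  have h3' : (n : ℝ) < (x + 1) * k := by exact_mod_cast h3
  have h5' : (x : ℝ) * k < n + k := by exact_mod_cast h5
  have h6 : (n : ℝ) / k < x + 1 := (div_lt_iff₀ hk').2 h3'
  have h7 : (x : ℝ) - 1 < n / k := (lt_div_iff₀ hk').2 (by linarith)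
  rw [abs_lt]; constructor <;> linarith

lemma dev_eq {n x k : ℕ} (hk : 0 < k) (hd : k ∣ n) (h1 : n / k ≤ x) (h2 : x ≤ (n + (k - 1)) / k) :
    (x : ℝ) = (n : ℝ) / (k : ℝ) := by
  obtain ⟨q, rfl⟩ := hd
  have h4 : x * k ≤ k * q + (k - 1) := (Nat.le_div_iff_mul_le hk).1 h2
  rw [Nat.mul_div_cancel_left q hk] at h1
  have h5 : x < q + 1 := by
    by_contra h
    have : (q + 1) * k ≤ x * k := Nat.mul_le_mul_right k (by omega)
    have h6 : (q + 1) * k = k * q + k := by ring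
    omega
  have h6 : x = q := by omega
  have hk' : (k : ℝ) ≠ 0 := by exact_mod_cast hk.ne'
  rw [h6]; push_cast; field_simp

variable {V E : Type*} [Fintype V] [Fintype E] [DecidableEq V]

lemma cutCard_eq (ends : E → V × V) (X : Finset V) : (cutCard ends X : ℤ) = dG ends X := by
  unfold cutCard dG
  rw [card_filter]
  push_cast
  refine sum_congr rfl fun e _ => ?_
  unfold inc ind
  by_cases h1 : (ends e).1 ∈ X <;> by_cases h2 : (ends e).2 ∈ X <;> simp [h1, h2]

lemma tree_Cr {ends : E → V × V} {T : Finset E} (hT : IsSpanningTree ends T) :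
    Cr univ ends T := by
  intro X _ ⟨a, ha⟩ hX
  obtain ⟨b, hb⟩ : ∃ b, b ∉ X := by
    by_contra! h
    exact hX (eq_univ_iff_forall.2 h)
  by_contra! hno
  have h := hT.1 a b
  apply hb
  induction h with
  | refl => exact ha
  | tail _ h2 ih =>
    rename_i c d _
    have hc : c ∈ X := by
      by_contra hc
      exact absurd (ih hc) hc
    obtain ⟨e, he, hcd⟩ := h2
    by_contra hd
    exact (cross_iff hcd (B := X)).2 (by simp [hc, hd]) (hno e he)

lemma onW_univ (ends : E → V × V) : OnW univ ends := fun e => ⟨mem_univ _, mem_univ _⟩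

lemma mdeg_int (ends : E → V × V) (v : V) :
    (mdeg ends univ v : ℤ) = ∑ e, (ind (ends e).1 {v} + ind (ends e).2 {v}) := by
  unfold mdeg ind
  rw [card_filter, card_filter, sum_add_distrib]
  push_cast
  simp

lemma sum_mdeg (ends : E → V × V) : ∑ v, (mdeg ends univ v : ℤ) = 2 * Fintype.card E := by
  simp only [mdeg_int]
  rw [sum_comm]
  have : ∀ e : E, ∑ v, (ind (ends e).1 {v} + ind (ends e).2 {v}) = 2 := by
    intro e
    rw [sum_add_distrib, ← ind_sum, ← ind_sum, ind_mem (mem_univ _), ind_mem (mem_univ _)]; rfl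
  rw [sum_congr rfl fun e _ => this e, sum_const, card_univ]
  simp [mul_comm]

/-- orientation with out-degrees divisible by `k` away from `z` -/
lemma orient (ends : E → V × V) (z : V) (k : ℕ) (hk : 2 ≤ k)
    (hconn : EdgeConn ends (3 * k - 3) ∨ TreeConn ends (2 * k - 2)) :
    ∃ t h : E → V, (∀ e, ends e = (t e, h e) ∨ ends e = (h e, t e)) ∧
      ∀ v, v ≠ z → k ∣ (univ.filter fun e => t e = v).card := by
  have hk' : (2 : ℤ) ≤ k := by exact_mod_cast hk
  let ρ : V → ℤ := fun v => (if v = z then 2 * (Fintype.card E : ℤ) else 0) - mdeg ends univ v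
  have rho : 2 * (k : ℤ) ∣ ∑ v ∈ univ, ρ v := by
    simp only [ρ]
    rw [sum_sub_distrib, sum_mdeg]
    simp
  have par : ∀ v ∈ (univ : Finset V), (2 : ℤ) ∣ ρ v - bd ends (fun _ => 1) {v} := by
    intro v _
    have h1 : (mdeg ends univ v : ℤ) + bd ends (fun _ => 1) {v} = 2 * ∑ e, ind (ends e).1 {v} := by
      rw [mdeg_int]; unfold bd inc
      rw [← sum_add_distrib, mul_sum]
      exact sum_congr rfl fun e _ => by ring
    simp only [ρ]
    split_ifs <;> omega
  have hsol : Sol (k : ℤ) univ ends ρ := by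
    rcases hconn with hc | ⟨T, hT, hS⟩
    · refine ec_sol hk' (onW_univ ends) rho par fun A _ h2 h3 => ?_
      rw [← cutCard_eq]
      have := hc A h2 h3
      omega
    · exact tree_sol hk' (m := 2 * k - 2) (by omega) _ univ ends ρ T rfl (onW_univ ends) rho par hT
        fun i => tree_Cr (hS i)
  obtain ⟨s, hs, hb⟩ := hsol
  refine ⟨fun e => if s e = 1 then (ends e).1 else (ends e).2,
    fun e => if s e = 1 then (ends e).2 else (ends e).1, ?_, ?_⟩
  · intro e; dsimp only; split_ifs
    · exact Or.inl rfl
    · exact Or.inr rfl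
  · intro v hv
    have h1 := hb v (mem_univ v)
    have h2 : bd ends s {v} - ρ v =
        2 * ((univ.filter fun e => (if s e = 1 then (ends e).1 else (ends e).2) = v).card : ℤ) := by
      simp only [ρ, hv, if_false]
      rw [mdeg_int, card_filter]
      unfold bd inc
      push_cast
      rw [zero_sub, sub_neg_eq_add, ← sum_add_distrib, mul_sum]
      refine sum_congr rfl fun e _ => ?_
      rcases hs e with h | h <;> rw [h] <;> simp [ind] <;> split_ifs <;> norm_num
    rw [h2] at h1
    have h3 := Int.dvd_of_mul_dvd_mul_left (by norm_num : (2 : ℤ) ≠ 0) h1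
    exact_mod_cast h3

lemma mdeg_orient {ends : E → V × V} {t h : E → V}
    (hth : ∀ e, ends e = (t e, h e) ∨ ends e = (h e, t e)) (S : Finset E) (v : V) :
    mdeg ends S v = (S.filter fun e => t e = v).card + (S.filter fun e => h e = v).card := by
  unfold mdeg
  simp only [card_filter]
  rw [← sum_add_distrib, ← sum_add_distrib]
  refine sum_congr rfl fun e _ => ?_
  rcases hth e with h | h <;> rw [h]
  exact add_comm _ _

theorem final (ends : E → V × V) (z : V) (k : ℕ) (hk : 2 ≤ k)
    (hconn : EdgeConn ends (3 * k - 3) ∨ TreeConn ends (2 * k - 2)) :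
    ∃ c : E → Fin k,
      (∀ i : Fin k,
        |(((univ.filter fun e : E => c e = i).card : ℝ)) -
          (Fintype.card E : ℝ) / (k : ℝ)| < 1) ∧
      (∀ v : V, v ≠ z → ∀ i : Fin k,
        |((mdeg ends (univ.filter fun e => c e = i) v : ℝ)) -
          (mdeg ends univ v : ℝ) / (k : ℝ)| < 1) ∧
      (∀ i : Fin k,
        |((mdeg ends (univ.filter fun e => c e = i) z : ℝ)) -
          (mdeg ends univ z : ℝ) / (k : ℝ)| < 2) := by
  obtain ⟨t, h, hth, hd⟩ := orient ends z k hk hconn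
  have hk0 : 0 < k := by omega
  obtain ⟨c, hc⟩ := equit t h k hk0
  have hff : ∀ (K : E → V) (v : V) (i : Fin k), ((univ.filter fun e => c e = i).filter fun e => K e = v) =
      univ.filter fun e => K e = v ∧ c e = i := by
    intro K v i; rw [filter_filter]; congr 1; ext e; exact and_comm
  refine ⟨c, ?_, ?_, ?_⟩
  · intro i
    have h1 : ((univ.filter fun e : E => c e = i).card : ℝ) =
        ∑ v, ((univ.filter fun e => t e = v ∧ c e = i).card : ℝ) := by
      rw [card_eq_sum_card_fiberwise (s := univ.filter fun e : E => c e = i) (f := t) (t := univ)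
        (fun e _ => mem_coe.2 (mem_univ _))]
      push_cast
      exact sum_congr rfl fun v _ => by rw [hff]
    have h2 : (Fintype.card E : ℝ) = ∑ v, ((univ.filter fun e => t e = v).card : ℝ) := by
      rw [← card_univ, card_eq_sum_card_fiberwise (s := (univ : Finset E)) (f := t) (t := univ)
        (fun e _ => mem_coe.2 (mem_univ _))]
      push_cast; rfl
    rw [h1, h2, sum_div, ← sum_sub_distrib, sum_eq_single z]
    · exact dev_lt hk0 (hc z i).1.1 (hc z i).1.2
    · intro v _ hv
      rw [dev_eq hk0 (hd v hv) (hc v i).1.1 (hc v i).1.2, sub_self]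
    · intro hz; exact (hz (mem_univ z)).elim
  · intro v hv i
    rw [mdeg_orient hth, mdeg_orient hth, hff, hff]
    push_cast
    rw [dev_eq hk0 (hd v hv) (hc v i).1.1 (hc v i).1.2, add_div, add_sub_add_left_eq_sub]
    exact dev_lt hk0 (hc v i).2.1 (hc v i).2.2
  · intro i
    rw [mdeg_orient hth, mdeg_orient hth, hff, hff]
    push_cast
    have h1 := dev_lt hk0 (hc z i).1.1 (hc z i).1.2
    have h2 := dev_lt hk0 (hc z i).2.1 (hc z i).2.2
    rw [add_div]
    rw [abs_lt] at *
    constructor <;> linarith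

end Final
end EqF

/-- Equitable factorization of a `(3k−3)`-edge-connected or `(2k−2)`-tree-connected
multigraph, with a relaxed bound at one distinguished vertex `z`. -/
theorem equitable_factorization_one_exception [Fintype V] [Fintype E] [DecidableEq V]
    (ends : E → V × V) (z : V) (k : ℕ) (hk : 0 < k)
    (hconn : EdgeConn ends (3 * k - 3) ∨ TreeConn ends (2 * k - 2)) :
    ∃ c : E → Fin k,
      (∀ i : Fin k,
        |(((univ.filter fun e : E => c e = i).card : ℝ)) -
          (Fintype.card E : ℝ) / (k : ℝ)| < 1) ∧
      (∀ v : V, v ≠ z → ∀ i : Fin k,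
        |((mdeg ends (univ.filter fun e => c e = i) v : ℝ)) -
          (mdeg ends univ v : ℝ) / (k : ℝ)| < 1) ∧
      (∀ i : Fin k,
        |((mdeg ends (univ.filter fun e => c e = i) z : ℝ)) -
          (mdeg ends univ z : ℝ) / (k : ℝ)| < 2) := by
  by_cases h2 : 2 ≤ k
  · exact EqF.final ends z k h2 hconn
  · have h1 : k = 1 := by omega
    subst h1
    have hf : ∀ i : Fin 1, (univ.filter fun _ : E => (0 : Fin 1) = i) = univ := fun i =>
      filter_true_of_mem fun e _ => Subsingleton.elim _ _
    refine ⟨fun _ => 0, ?_, ?_, ?_⟩ <;> intros <;> rw [hf] <;> simp
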